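/- Assume the Riemann Hypothesis. Then there is a constant C > 0 such that for all x ≥ 5, | ∏_{p≤x}(1−1/p)^{-1} − e^γ log x − e^γ E_M(x)/√x | ≤ C (log x)³/x. -/

import Mathlib

open Filter Real Set

/-- The Mertens product `∏_{p ≤ x} (1 - 1/p)⁻¹`. -/
noncomputable def mertensProd (x : ℝ) : ℝ :=
  ∏ p ∈ Finset.filter Nat.Prime (Finset.Iic ⌊x⌋₊), ((1 : ℝ) - 1 / p)⁻¹

/-- `E_M(x) = √x log x (log ∏_{p≤x}(1-1/p)⁻¹ - log log x - γ)`. -/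
noncomputable def EM (x : ℝ) : ℝ :=
  Real.sqrt x * Real.log x *
    (Real.log (mertensProd x) - Real.log (Real.log x) - Real.eulerMascheroniConstant)

section LocalFactorization
open Metric
open scoped ComplexConjugate

lemma norm_sq_sub_conj_mul_of_norm_eq {R : ℝ} {ρ z : ℂ} (hz : ‖z‖ = R) :
    ‖(R : ℂ) ^ 2 - conj ρ * z‖ = R * ‖z - ρ‖ := by
  have h : (R : ℂ) ^ 2 - conj ρ * z = z * conj (z - ρ) := by
    rw [← hz, map_sub, mul_sub, Complex.mul_conj']
    ring
  rw [h, norm_mul, Complex.norm_conj, hz]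

/-- If an entire function bounded by `M` on the circle of radius `R` has the zeros `ρ i` in the
disc of radius `r`, then dividing out the corresponding Blaschke factors keeps the bound `M`. -/
lemma norm_mul_prod_blaschke_le {R M : ℝ} (hR : 0 < R) {f g : ℂ → ℂ} {N : ℕ} {ρ : Fin N → ℂ}
    (hg : Differentiable ℂ g) (hfg : ∀ z, f z = (∏ i, (z - ρ i)) * g z)
    (hM : ∀ z, ‖z‖ = R → ‖f z‖ ≤ M) {z : ℂ} (hz : ‖z‖ ≤ R) :
    ‖g z * ∏ i, (((R : ℂ) ^ 2 - conj (ρ i) * z) / R)‖ ≤ M := by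
  have hd : Differentiable ℂ fun z ↦ g z * ∏ i, (((R : ℂ) ^ 2 - conj (ρ i) * z) / R) := by
    fun_prop
  refine Complex.norm_le_of_forall_mem_frontier_norm_le (U := ball 0 R) isBounded_ball
    hd.diffContOnCl (fun w hw ↦ ?_) (by rw [closure_ball _ hR.ne']; simpa using hz)
  rw [frontier_ball _ hR.ne', mem_sphere_zero_iff_norm] at hw
  have : ‖g w * ∏ i, (((R : ℂ) ^ 2 - conj (ρ i) * w) / R)‖ = ‖f w‖ := by
    rw [hfg, norm_mul, norm_mul, mul_comm, norm_prod, norm_prod]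
    congr 1
    refine Finset.prod_congr rfl fun i _ ↦ ?_
    rw [norm_div, norm_sq_sub_conj_mul_of_norm_eq hw, Complex.norm_real, norm_of_nonneg hR.le]
    field_simp
  exact this ▸ hM w hw

lemma norm_mul_pow_le_of_factorization {R r M : ℝ} (hR : 0 < R) {f g : ℂ → ℂ} {N : ℕ}
    {ρ : Fin N → ℂ} (hρ : ∀ i, ‖ρ i‖ ≤ r)
    (hg : Differentiable ℂ g) (hfg : ∀ z, f z = (∏ i, (z - ρ i)) * g z)
    (hM : ∀ z, ‖z‖ = R → ‖f z‖ ≤ M) : ‖f 0‖ * R ^ N ≤ ‖g 0‖ * r ^ N * R ^ N ∧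
      ‖g 0‖ * R ^ N ≤ M := by
  constructor
  · gcongr
    rw [hfg, norm_mul, norm_prod, mul_comm]
    gcongr
    calc ∏ i, ‖0 - ρ i‖ ≤ ∏ _i : Fin N, r :=
          Finset.prod_le_prod (fun _ _ ↦ norm_nonneg _) (fun i _ ↦ by simpa using hρ i)
      _ = r ^ N := by simp
  · have := norm_mul_prod_blaschke_le hR hg hfg hM (z := 0) (by simpa using hR.le)
    simpa [norm_mul, norm_prod, sq, hR.ne', abs_of_pos hR] using this

/-- All zeros of an entire function in a disc can be divided out. -/
lemma exists_factorization_ne_zero {R r M : ℝ} (hr : 0 < r) (hrR : r < R) {f : ℂ → ℂ}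
    (hf : Differentiable ℂ f) (hf0 : f 0 ≠ 0) (hM : ∀ z, ‖z‖ = R → ‖f z‖ ≤ M) :
    ∃ (N : ℕ) (ρ : Fin N → ℂ) (g : ℂ → ℂ), (∀ i, ‖ρ i‖ ≤ r) ∧ Differentiable ℂ g ∧
      (∀ z, f z = (∏ i, (z - ρ i)) * g z) ∧ ∀ z, ‖z‖ ≤ r → g z ≠ 0 := by
  by_contra! hcon
  have key : ∀ N : ℕ, ∃ (ρ : Fin N → ℂ) (g : ℂ → ℂ), (∀ i, ‖ρ i‖ ≤ r) ∧ Differentiable ℂ g ∧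
      (∀ z, f z = (∏ i, (z - ρ i)) * g z) := by
    intro N
    induction N with
    | zero => exact ⟨Fin.elim0, f, fun i ↦ i.elim0, hf, by simp⟩
    | succ N ih =>
      obtain ⟨ρ, g, hρ, hg, hfg⟩ := ih
      obtain ⟨a, ha, hga⟩ := hcon N ρ g hρ hg hfg
      refine ⟨Fin.cons a ρ, dslope g a, fun i ↦ ?_, ?_, fun z ↦ ?_⟩
      · refine Fin.cases ?_ (fun j ↦ ?_) i
        · simpa using ha
        · simpa using hρ j
      · rw [← differentiableOn_univ, Complex.differentiableOn_dslope univ_mem, differentiableOn_univ]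
        exact hg
      · have := sub_smul_dslope g a z
        rw [hga, sub_zero, smul_eq_mul] at this
        rw [hfg, Fin.prod_univ_succ, ← this]
        simp only [Fin.cons_zero, Fin.cons_succ]
        ring
  have hR : 0 < R := hr.trans hrR
  have hb : ∀ N : ℕ, ‖f 0‖ ≤ M * (r / R) ^ N := by
    intro N
    obtain ⟨ρ, g, hρ, hg, hfg⟩ := key N
    obtain ⟨h1, h2⟩ := norm_mul_pow_le_of_factorization hR hρ hg hfg hM
    have h3 : ‖f 0‖ * R ^ N ≤ M * r ^ N := by
      calc _ ≤ _ := h1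
        _ = ‖g 0‖ * R ^ N * r ^ N := by ring
        _ ≤ _ := by gcongr
    rw [div_pow, ← mul_div_assoc, le_div_iff₀ (by positivity)]
    exact h3
  have hlim : Tendsto (fun N : ℕ ↦ M * (r / R) ^ N) atTop (nhds (M * 0)) :=
    (tendsto_pow_atTop_nhds_zero_of_lt_one (by positivity) ((div_lt_one hR).2 hrR)).const_mul M
  have := ge_of_tendsto' hlim hb
  rw [mul_zero] at this
  exact hf0 (norm_le_zero_iff.1 this)

lemma exists_log_on_ball {r : ℝ} (hr : 0 < r) {h : ℂ → ℂ} (hh : Differentiable ℂ h)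
    (h0 : ∀ z ∈ ball (0 : ℂ) r, h z ≠ 0) :
    ∃ l : ℂ → ℂ, DifferentiableOn ℂ l (ball 0 r) ∧ l 0 = 0 ∧
      (∀ z ∈ ball (0 : ℂ) r, deriv l z = logDeriv h z) ∧
      ∀ z ∈ ball (0 : ℂ) r, h z = h 0 * Complex.exp (l z) := by
  have hd : DifferentiableOn ℂ (logDeriv h) (ball 0 r) := by
    intro z hz
    exact ((hh.deriv z).div (hh z) (h0 z hz)).differentiableWithinAt
  obtain ⟨l, hl⟩ := hd.isExactOn_ball
  obtain ⟨l, hl0, hl⟩ := hd.isExactOn_ball.with_val_at 0 0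
  refine ⟨l, fun z hz ↦ (hl z hz).differentiableAt.differentiableWithinAt, hl0,
    fun z hz ↦ (hl z hz).deriv, fun z hz ↦ ?_⟩
  have hder : ∀ w ∈ ball (0 : ℂ) r, HasDerivAt (fun z ↦ h z * Complex.exp (-l z)) 0 w := by
    intro w hw
    convert! (hh w).hasDerivAt.mul ((hl w hw).neg.cexp) using 1
    rw [logDeriv_apply]
    field_simp [h0 w hw]
    ring
  have hc := (convex_ball (0 : ℂ) r).is_const_of_fderivWithin_eq_zero (𝕜 := ℂ)
    (f := fun z ↦ h z * Complex.exp (-l z))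
    (fun w hw ↦ (hder w hw).differentiableAt.differentiableWithinAt)
    (fun w hw ↦ by
      rw [fderivWithin_of_isOpen isOpen_ball hw, (hder w hw).hasFDerivAt.fderiv]
      ext; simp) (mem_ball_self hr) hz
  simp only [hl0, neg_zero, Complex.exp_zero, mul_one] at hc
  rw [hc, mul_assoc, ← Complex.exp_add]
  simp

/-- Borel-Carathéodory and Cauchy bound the logarithmic derivative of a function without zeros. -/
lemma norm_logDeriv_le_of_ne_zero {r r₁ r₂ M : ℝ} (hr₂ : 0 < r₂) (h₂₁ : r₂ < r₁) (h₁ : r₁ < r)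
    {h : ℂ → ℂ} (hh : Differentiable ℂ h) (h0 : ∀ z ∈ ball (0 : ℂ) r, h z ≠ 0)
    (hlt : ‖h 0‖ < M) (hM : ∀ z ∈ ball (0 : ℂ) r, ‖h z‖ ≤ M) {z : ℂ} (hz : ‖z‖ ≤ r₂) :
    ‖logDeriv h z‖ ≤ 2 * r₁ / ((r - r₁) * (r₁ - r₂)) * log (M / ‖h 0‖) := by
  have hr : 0 < r := by linarith
  obtain ⟨l, hl, hl0, hld, hexp⟩ := exists_log_on_ball hr hh h0
  have hp : 0 < ‖h 0‖ := norm_pos_iff.2 (h0 0 (mem_ball_self hr))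
  have hMp : 0 < M := hp.trans hlt
  have hr₁ : 0 < r₁ := hr₂.trans h₂₁
  have hA : 0 < log (M / ‖h 0‖) := Real.log_pos ((one_lt_div hp).2 hlt)
  have hre : MapsTo l (ball 0 r) {z | z.re ≤ log (M / ‖h 0‖)} := by
    intro w hw
    have := hM w hw
    rw [hexp w hw, norm_mul, Complex.norm_exp] at this
    change (l w).re ≤ _
    rw [Real.le_log_iff_exp_le (by positivity), le_div_iff₀ hp]
    linarith
  have hbound : ∀ w, ‖w‖ ≤ r₁ → ‖l w‖ ≤ 2 * log (M / ‖h 0‖) * r₁ / (r - r₁) := by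
    intro w hw
    have hwr : w ∈ ball (0 : ℂ) r := by rw [mem_ball_zero_iff]; linarith
    refine (Complex.borelCaratheodory_zero hA hl hre hr hwr hl0).trans ?_
    have : 0 < r - r₁ := by linarith
    gcongr
  have hzr : z ∈ ball (0 : ℂ) r := by rw [mem_ball_zero_iff]; linarith
  rw [← hld z hzr]
  have hsub : closedBall z (r₁ - r₂) ⊆ ball 0 r := by
    intro w hw
    rw [mem_closedBall, dist_eq_norm] at hw
    rw [mem_ball_zero_iff]
    have := norm_add_le (w - z) z
    rw [sub_add_cancel] at this
    linarith
  refine (Complex.norm_deriv_le_of_forall_mem_sphere_norm_le (sub_pos.2 h₂₁)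
    (hl.mono hsub |>.diffContOnCl_ball subset_rfl) (C := 2 * log (M / ‖h 0‖) * r₁ / (r - r₁))
    fun w hw ↦ hbound w ?_).trans_eq ?_
  · rw [mem_sphere, dist_eq_norm] at hw
    have := norm_add_le (w - z) z
    rw [sub_add_cancel] at this
    linarith
  · rw [div_div, div_mul_eq_mul_div]
    ring_nf

/-- Landau's local partial fraction expansion of the logarithmic derivative, with uniform
constants. -/
theorem exists_norm_logDeriv_sub_sum_le {r₂ R : ℝ} (hr₂ : 0 < r₂) (hR : r₂ < R) :
    ∃ K : ℝ, 0 < K ∧ ∀ (f : ℂ → ℂ) (M : ℝ), Differentiable ℂ f → f 0 ≠ 0 → ‖f 0‖ < M →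
      (∀ z, ‖z‖ = R → ‖f z‖ ≤ M) →
      ∃ (N : ℕ) (ρ : Fin N → ℂ), (∀ i, f (ρ i) = 0 ∧ ‖ρ i‖ ≤ R) ∧ N ≤ K * log (M / ‖f 0‖) ∧
        ∀ z, ‖z‖ ≤ r₂ → f z ≠ 0 →
          ‖logDeriv f z - ∑ i, 1 / (z - ρ i)‖ ≤ K * log (M / ‖f 0‖) := by
  obtain ⟨r₁, h21, h1R⟩ := exists_between hR
  obtain ⟨r, h1r, hrR⟩ := exists_between h1R
  have hr : 0 < r := by linarith
  have hRp : 0 < R := by linarith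
  have hlog : 0 < log (R / r) := Real.log_pos ((one_lt_div hr).2 hrR)
  have hRr : 0 < R ^ 2 - r * r := by nlinarith
  set K₁ := 1 / log (R / r)
  set K₂ := 2 * r₁ / ((r - r₁) * (r₁ - r₂))
  have hK₁ : 0 < K₁ := by positivity
  have hK₂ : 0 < K₂ := by
    have : 0 < r - r₁ := by linarith
    have : 0 < r₁ - r₂ := by linarith
    have : 0 < r₁ := by linarith
    positivity
  refine ⟨K₁ + K₂ + K₁ * (r / (R ^ 2 - r * r)), by positivity, fun f M hf hf0 hlt hM ↦ ?_⟩
  obtain ⟨N, ρ, g, hρ, hg, hfg, hg0⟩ := exists_factorization_ne_zero hr hrR hf hf0 hM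
  obtain ⟨hN1, hN2⟩ := norm_mul_pow_le_of_factorization hRp hρ hg hfg hM
  have hfp : 0 < ‖f 0‖ := norm_pos_iff.2 hf0
  have hMp : 0 < M := hfp.trans hlt
  set A := log (M / ‖f 0‖)
  have hA : 0 < A := Real.log_pos ((one_lt_div hfp).2 hlt)
  have hNA : (N : ℝ) ≤ K₁ * A := by
    rw [one_div_mul_eq_div, le_div_iff₀ hlog, ← Real.log_pow]
    refine Real.log_le_log (by positivity) ?_
    rw [div_pow, div_le_div_iff₀ (by positivity) hfp]
    calc R ^ N * ‖f 0‖ = ‖f 0‖ * R ^ N := mul_comm _ _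
      _ ≤ _ := hN1
      _ = ‖g 0‖ * R ^ N * r ^ N := by ring
      _ ≤ _ := by gcongr
  refine ⟨N, ρ, fun i ↦ ⟨?_, (hρ i).trans hrR.le⟩, hNA.trans ?_, fun z hz hfz ↦ ?_⟩
  · rw [hfg, Finset.prod_eq_zero (Finset.mem_univ i) (sub_self _), zero_mul]
  · gcongr
    have : 0 < K₁ * (r / (R ^ 2 - r * r)) := by positivity
    linarith
  set B : ℂ → ℂ := fun z ↦ ∏ i, (((R : ℂ) ^ 2 - conj (ρ i) * z) / R)
  have hBd : Differentiable ℂ B := by fun_prop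
  have hlow : ∀ w, ‖w‖ ≤ r → ∀ i, R ^ 2 - r * r ≤ ‖(R : ℂ) ^ 2 - conj (ρ i) * w‖ := by
    intro w hw i
    have h1 := norm_sub_norm_le ((R : ℂ) ^ 2) (conj (ρ i) * w)
    rw [norm_mul, Complex.norm_conj, norm_pow, Complex.norm_real, norm_of_nonneg hRp.le] at h1
    have : ‖ρ i‖ * ‖w‖ ≤ r * r := by gcongr; exact hρ i
    linarith
  have hne : ∀ w, ‖w‖ ≤ r → ∀ i, (R : ℂ) ^ 2 - conj (ρ i) * w ≠ 0 := by
    intro w hw i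
    exact norm_pos_iff.1 (hRr.trans_le (hlow w hw i))
  have hRc : (R : ℂ) ≠ 0 := by exact_mod_cast hRp.ne'
  have hB0 : ∀ w, ‖w‖ ≤ r → B w ≠ 0 := fun w hw ↦
    Finset.prod_ne_zero_iff.2 fun i _ ↦ div_ne_zero (hne w hw i) hRc
  have hzr : ‖z‖ ≤ r := by linarith
  have hg00 : ‖f 0‖ ≤ ‖g 0 * B 0‖ := by
    have : ‖g 0 * B 0‖ = ‖g 0‖ * R ^ N := by
      have h1 : ∀ i, ((R : ℂ) ^ 2 - conj (ρ i) * 0) / R = R := fun i ↦ by field_simp; simp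
      simp only [B, h1]
      simp [abs_of_pos hRp]
    rw [this]
    have hpos : 0 < R ^ N := by positivity
    have h1 : ‖f 0‖ ≤ ‖g 0‖ * r ^ N := le_of_mul_le_mul_right hN1 hpos
    exact h1.trans (by gcongr)
  have hgB : Differentiable ℂ fun z ↦ g z * B z := hg.mul hBd
  have hH : ‖logDeriv (fun z ↦ g z * B z) z‖ ≤ K₂ * A := by
    have hle : ∀ w ∈ ball (0 : ℂ) r, ‖g w * B w‖ ≤ M := fun w hw ↦
      norm_mul_prod_blaschke_le hRp hg hfg hM (by rw [mem_ball_zero_iff] at hw; linarith)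
    have hnz : ∀ w ∈ ball (0 : ℂ) r, g w * B w ≠ 0 := fun w hw ↦ by
      rw [mem_ball_zero_iff] at hw
      exact mul_ne_zero (hg0 w hw.le) (hB0 w hw.le)
    rcases (hle 0 (mem_ball_self hr)).lt_or_eq with h | h
    · refine (norm_logDeriv_le_of_ne_zero hr₂ h21 h1r hgB hnz h hle hz).trans ?_
      refine mul_le_mul_of_nonneg_left (Real.log_le_log (div_pos hMp (norm_pos_iff.2
        (hnz 0 (mem_ball_self hr)))) (by gcongr)) hK₂.le
    · have h2 : ‖g 0 * B 0‖ < M * (M / ‖f 0‖) := by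
        rw [h]; exact lt_mul_of_one_lt_right hMp ((one_lt_div hfp).2 hlt)
      refine (norm_logDeriv_le_of_ne_zero hr₂ h21 h1r hgB hnz h2
        (fun w hw ↦ (hle w hw).trans (h ▸ h2.le)) hz).trans ?_
      rw [h, mul_div_cancel_left₀ _ hMp.ne']
  have hfact : ∀ i, z - ρ i ≠ 0 := by
    intro i
    rw [hfg] at hfz
    exact Finset.prod_ne_zero_iff.1 (left_ne_zero_of_mul hfz) i (Finset.mem_univ i)
  have hlf : logDeriv f z = ∑ i, 1 / (z - ρ i) + logDeriv g z := by
    rw [show f = fun z ↦ (∏ i, (z - ρ i)) * g z from funext hfg,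
      logDeriv_mul (f := fun z ↦ ∏ i, (z - ρ i)) (g := g) _ (Finset.prod_ne_zero_iff.2 fun i _ ↦ hfact i) (hg0 z hzr) (by fun_prop) (hg z)]
    congr 1
    rw [logDeriv_prod (fun i _ ↦ hfact i) (fun i _ ↦ by fun_prop)]
    refine Finset.sum_congr rfl fun i _ ↦ ?_
    simp [logDeriv_apply]
  have hlB : logDeriv B z = ∑ i, (-conj (ρ i) / ((R : ℂ) ^ 2 - conj (ρ i) * z)) := by
    have := logDeriv_prod (s := Finset.univ) (f := fun i z ↦ ((R : ℂ) ^ 2 - conj (ρ i) * z) / R)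
      (x := z) (fun i _ ↦ div_ne_zero (hne z hzr i) hRc) (fun i _ ↦ by fun_prop)
    rw [this]
    refine Finset.sum_congr rfl fun i _ ↦ ?_
    have hd : HasDerivAt (fun w ↦ ((R : ℂ) ^ 2 - conj (ρ i) * w) / R) (-(conj (ρ i) * 1) / R) z :=
      (((hasDerivAt_id z).const_mul _).const_sub _).div_const _
    rw [logDeriv_apply, hd.deriv]
    field_simp
  have hBb : ‖logDeriv B z‖ ≤ K₁ * (r / (R ^ 2 - r * r)) * A := by
    rw [hlB]
    calc _ ≤ ∑ _i : Fin N, r / (R ^ 2 - r * r) := by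
          refine norm_sum_le_of_le _ fun i _ ↦ ?_
          rw [norm_div, norm_neg, Complex.norm_conj]
          exact div_le_div₀ hr.le (hρ i) hRr (hlow z hzr i)
      _ = N * (r / (R ^ 2 - r * r)) := by simp
      _ ≤ K₁ * A * (r / (R ^ 2 - r * r)) := by gcongr
      _ = _ := by ring
  rw [logDeriv_mul _ (hg0 z hzr) (hB0 z hzr) (hg z) (hBd z)] at hH
  have : logDeriv f z - ∑ i, 1 / (z - ρ i) = (logDeriv g z + logDeriv B z) - logDeriv B z := by
    rw [hlf]; ring
  rw [this]
  calc _ ≤ _ := norm_sub_le _ _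
    _ ≤ K₂ * A + K₁ * (r / (R ^ 2 - r * r)) * A := add_le_add hH hBb
    _ ≤ _ := by nlinarith [mul_pos hK₁ hA]

end LocalFactorization

section ZetaGrowth
open MeasureTheory

lemma mellin_fract_eq (s : ℂ) :
    mellin ((Ioi (1 : ℝ)).indicator fun x ↦ ((Int.fract x : ℝ) : ℂ)) (-s) =
      ∫ t in Ioi (1 : ℝ), ((Int.fract t : ℝ) : ℂ) * (t : ℂ) ^ (-(s + 1)) := by
  rw [mellin, ← integral_indicator measurableSet_Ioi, ← integral_indicator measurableSet_Ioi]
  congr 1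
  ext t
  by_cases ht : t ∈ Ioi (1 : ℝ)
  · have h0 : t ∈ Ioi (0 : ℝ) := mem_Ioi.2 (zero_lt_one.trans ht)
    simp only [indicator_of_mem ht, indicator_of_mem h0, smul_eq_mul]
    rw [mul_comm, show -(s + 1) = -s - 1 by ring]
  · simp [indicator_of_notMem ht]

lemma differentiableAt_mellin_fract {s : ℂ} (hs : 0 < s.re) :
    DifferentiableAt ℂ (fun s : ℂ ↦
      ∫ t in Ioi (1 : ℝ), ((Int.fract t : ℝ) : ℂ) * (t : ℂ) ^ (-(s + 1))) s := by
  simp_rw [← mellin_fract_eq]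
  have hb : ∀ x : ℝ, ‖(Ioi (1 : ℝ)).indicator (fun x ↦ ((Int.fract x : ℝ) : ℂ)) x‖ ≤ 1 := by
    intro x
    by_cases ht : x ∈ Ioi (1 : ℝ)
    · rw [indicator_of_mem ht, Complex.norm_real, norm_of_nonneg (Int.fract_nonneg x)]
      exact (Int.fract_lt_one x).le
    · simp [indicator_of_notMem ht]
  have hm : Measurable ((Ioi (1 : ℝ)).indicator fun x ↦ ((Int.fract x : ℝ) : ℂ)) :=
    (Complex.measurable_ofReal.comp measurable_fract).indicator measurableSet_Ioi
  refine DifferentiableAt.comp (g := mellin _) (f := fun s : ℂ ↦ -s) s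
    (mellin_differentiableAt_of_isBigO_rpow (a := 0)
    (b := -s.re - 1) ?_ ?_ (by simpa using hs) ?_ (by simp)) differentiableAt_id.neg
  · refine LocallyIntegrable.locallyIntegrableOn (fun x ↦ ?_) _
    refine ⟨Icc (x - 1) (x + 1), Icc_mem_nhds (by linarith) (by linarith), ?_⟩
    exact Measure.integrableOn_of_bounded (M := 1) (by simp) hm.aestronglyMeasurable
      (ae_of_all _ hb)
  · refine Asymptotics.IsBigO.of_bound 1 (Eventually.of_forall fun x ↦ ?_)
    simpa using hb x
  · refine Asymptotics.IsBigO.of_bound 1 ?_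
    filter_upwards [mem_nhdsWithin_of_mem_nhds (Iio_mem_nhds zero_lt_one)] with x hx
    rw [indicator_of_notMem (by simpa using hx.le)]
    simp

lemma riemannZeta₁_eq_of_one_lt_re {s : ℂ} (hs : 1 < s.re) :
    riemannZeta₁ s = s - s * (s - 1) *
      ∫ t in Ioi (1 : ℝ), ((Int.fract t : ℝ) : ℂ) * (t : ℂ) ^ (-(s + 1)) := by
  have hs1 : s ≠ 1 := fun h ↦ by simp [h] at hs
  have hs1' : s - 1 ≠ 0 := sub_ne_zero.2 hs1
  have hs0 : 0 < s.re := by linarith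
  have h1 := LSeries_eq_mul_integral_of_nonneg (fun _ ↦ 1) zero_le_one hs
    (by simpa using Asymptotics.isBigO_refl _ _) (fun _ ↦ zero_le_one)
  have h2 : riemannZeta s = LSeries (fun n : ℕ ↦ ((1 : ℝ) : ℂ)) s := by
    rw [← LSeries_one_eq_riemannZeta hs]
    exact LSeries_congr (fun _ ↦ by simp) s
  rw [h1] at h2
  have hz : riemannZeta₁ s = (s - 1) * riemannZeta s := by
    rw [riemannZeta_eq_inv_sub_mul hs1]; field_simp
  have hi1 : IntegrableOn (fun t : ℝ ↦ (t : ℂ) ^ (-s)) (Ioi 1) :=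
    integrableOn_Ioi_cpow_of_lt (by simpa using hs) zero_lt_one
  have hi2 : IntegrableOn (fun t : ℝ ↦ ((Int.fract t : ℝ) : ℂ) * (t : ℂ) ^ (-(s + 1))) (Ioi 1) := by
    refine Integrable.bdd_mul (c := 1) (integrableOn_Ioi_cpow_of_lt (by simpa using hs0) zero_lt_one)
      (Complex.measurable_ofReal.comp measurable_fract).aestronglyMeasurable
      (ae_of_all _ fun x ↦ ?_)
    simp only [Complex.norm_real, norm_of_nonneg (Int.fract_nonneg x)]
    exact (Int.fract_lt_one x).le
  have h3 : ∫ t in Ioi (1 : ℝ), (∑ k ∈ Finset.Icc 1 ⌊t⌋₊, ((1 : ℝ) : ℂ)) * t ^ (-(s + 1)) =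
      ∫ t in Ioi (1 : ℝ), ((t : ℂ) ^ (-s) - ((Int.fract t : ℝ) : ℂ) * (t : ℂ) ^ (-(s + 1))) := by
    refine setIntegral_congr_fun measurableSet_Ioi fun t ht ↦ ?_
    have ht0 : (0 : ℝ) < t := zero_lt_one.trans ht
    have ht' : (t : ℂ) ≠ 0 := by exact_mod_cast ht0.ne'
    have : (t : ℂ) ^ (-s) = t * (t : ℂ) ^ (-(s + 1)) := by
      nth_rw 2 [← Complex.cpow_one (t : ℂ)]
      rw [← Complex.cpow_add _ _ ht']; ring_nf
    have h4 : ((⌊t⌋₊ : ℝ) : ℂ) = ((t - Int.fract t : ℝ) : ℂ) := by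
      rw [Int.self_sub_fract, natCast_floor_eq_intCast_floor ht0.le]
    simp only [this, Finset.sum_const, Nat.card_Icc, add_tsub_cancel_right]
    rw [← sub_mul]
    push_cast at h4 ⊢
    rw [← h4]; simp
  rw [hz, h2, h3, integral_sub hi1 hi2, integral_Ioi_cpow_of_lt (by simpa using hs) zero_lt_one]
  have : -s + 1 ≠ 0 := fun h ↦ hs1' (by linear_combination -h)
  simp
  field_simp
  ring

lemma riemannZeta₁_eq_of_re_pos {s : ℂ} (hs : 0 < s.re) :
    riemannZeta₁ s = s - s * (s - 1) *
      ∫ t in Ioi (1 : ℝ), ((Int.fract t : ℝ) : ℂ) * (t : ℂ) ^ (-(s + 1)) := by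
  have ho : IsOpen {s : ℂ | 0 < s.re} := isOpen_lt continuous_const Complex.continuous_re
  have hd : DifferentiableOn ℂ (fun s : ℂ ↦ s - s * (s - 1) *
      ∫ t in Ioi (1 : ℝ), ((Int.fract t : ℝ) : ℂ) * (t : ℂ) ^ (-(s + 1))) {s : ℂ | 0 < s.re} := by
    intro w hw
    have := differentiableAt_mellin_fract hw
    exact (by fun_prop : DifferentiableAt ℂ _ w).differentiableWithinAt
  refine AnalyticOnNhd.eqOn_of_preconnected_of_eventuallyEq
    (differentiable_riemannZeta₁.differentiableOn.analyticOnNhd ho) (hd.analyticOnNhd ho)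
    (convex_halfSpace_re_gt 0).isPreconnected (z₀ := 2) (by simp) ?_ hs
  filter_upwards [(isOpen_lt continuous_const Complex.continuous_re).mem_nhds
    (show (1 : ℝ) < (2 : ℂ).re by simp)] with w hw
  exact riemannZeta₁_eq_of_one_lt_re hw

lemma norm_riemannZeta₁_le {s : ℂ} (hs : 0 < s.re) :
    ‖riemannZeta₁ s‖ ≤ ‖s‖ + ‖s‖ * ‖s - 1‖ / s.re := by
  rw [riemannZeta₁_eq_of_re_pos hs]
  refine (norm_sub_le _ _).trans ?_
  rw [norm_mul, norm_mul, div_eq_mul_inv]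
  gcongr
  calc _ ≤ ∫ t in Ioi (1 : ℝ), t ^ (-(s.re + 1)) := by
        refine norm_integral_le_of_norm_le
          (integrableOn_Ioi_rpow_of_lt (by linarith) zero_lt_one) ?_
        refine (ae_restrict_mem measurableSet_Ioi).mono fun t ht ↦ ?_
        rw [norm_mul, Complex.norm_real, norm_of_nonneg (Int.fract_nonneg t),
          Complex.norm_cpow_eq_rpow_re_of_pos (zero_lt_one.trans ht)]
        simpa using mul_le_of_le_one_left (rpow_nonneg (zero_lt_one.trans ht).le _)
          (Int.fract_lt_one t).le
    _ = s.re⁻¹ := by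
        rw [integral_Ioi_rpow_of_lt (by linarith) zero_lt_one]
        simp [neg_div_neg_eq]

lemma one_third_le_norm_riemannZeta {s : ℂ} (hs : s.re = 2) : 1 / 3 ≤ ‖riemannZeta s‖ := by
  have hs1 : 1 < s.re := by rw [hs]; norm_num
  have hs' : Summable fun n : ℕ ↦ 1 / ((n : ℝ) + 1) ^ 2 := by
    simpa using (summable_nat_add_iff 1).2 (Real.summable_one_div_nat_pow.2 one_lt_two)
  have h2 : ∑' n : ℕ, 1 / ((n : ℝ) + 1) ^ 2 = π ^ 2 / 6 := by
    have := hasSum_zeta_two.tsum_eq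
    rw [hasSum_zeta_two.summable.tsum_eq_zero_add] at this
    simpa using this
  have hn : ∀ n : ℕ, ‖1 / ((n : ℂ) + 1) ^ s‖ = 1 / ((n : ℝ) + 1) ^ 2 := by
    intro n
    rw [norm_div, norm_one]
    congr 1
    have : ((n : ℂ) + 1) = ((n + 1 : ℝ) : ℂ) := by push_cast; rfl
    rw [this, Complex.norm_cpow_eq_rpow_re_of_pos (by positivity), hs]
    norm_cast
  have hsum : Summable fun n : ℕ ↦ 1 / ((n : ℂ) + 1) ^ s := by
    refine Summable.of_norm ?_
    simpa only [hn] using hs'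
  rw [zeta_eq_tsum_one_div_nat_add_one_cpow hs1, hsum.tsum_eq_zero_add]
  have htail : ‖∑' n : ℕ, 1 / (((n + 1 : ℕ) : ℂ) + 1) ^ s‖ ≤ π ^ 2 / 6 - 1 := by
    rw [← h2, hs'.tsum_eq_zero_add]
    have hsum1 : Summable fun n : ℕ ↦ ‖1 / (((n + 1 : ℕ) : ℂ) + 1) ^ s‖ :=
      hsum.norm.comp_injective (add_left_injective 1)
    refine (norm_tsum_le_tsum_norm hsum1).trans_eq ?_
    rw [tsum_congr fun n ↦ hn (n + 1)]
    simp
  have hpi : π ^ 2 ≤ 10 := by nlinarith [pi_lt_d2, pi_pos]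
  have := norm_sub_norm_le (1 : ℂ) (-∑' n : ℕ, 1 / (((n + 1 : ℕ) : ℂ) + 1) ^ s)
  rw [norm_neg, norm_one, sub_neg_eq_add] at this
  simp only [Nat.cast_zero, zero_add, Complex.one_cpow, div_one]
  linarith

end ZetaGrowth

section ZetaLogDeriv
open MeasureTheory

lemma exists_logDeriv_riemannZeta₁_sub_sum_le : ∃ K : ℝ, 0 < K ∧ ∀ t : ℝ,
    ∃ (N : ℕ) (ρ : Fin N → ℂ), (∀ i, riemannZeta₁ (ρ i) = 0 ∧ 0 < (ρ i).re) ∧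
      N ≤ K * log (|t| + 3) ∧ ∀ s : ℂ, ‖s - (2 + t * Complex.I)‖ ≤ 8 / 5 → riemannZeta₁ s ≠ 0 →
        ‖logDeriv riemannZeta₁ s - ∑ i, 1 / (s - ρ i)‖ ≤ K * log (|t| + 3) := by
  obtain ⟨K, hK, h⟩ := exists_norm_logDeriv_sub_sum_le (r₂ := 8 / 5) (R := 19 / 10)
    (by norm_num) (by norm_num)
  refine ⟨K * 7, by positivity, fun t ↦ ?_⟩
  set T := |t| + 3
  have hT : 3 ≤ T := by simp [T]
  set c : ℂ := 2 + t * Complex.I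
  have hcre : c.re = 2 := by simp [c]
  have hcn : ‖c‖ ≤ |t| + 2 := by
    refine (norm_add_le _ _).trans ?_
    simp; linarith
  have hc1 : 1 ≤ ‖c - 1‖ := by
    refine le_trans ?_ (Complex.abs_re_le_norm _)
    simp [hcre]; norm_num
  have hf0 : 1 / 3 ≤ ‖riemannZeta₁ c‖ := by
    have hc : c ≠ 1 := fun h ↦ by simp [h] at hcre
    have hz := one_third_le_norm_riemannZeta hcre
    have : riemannZeta₁ c = (c - 1) * riemannZeta c := by
      rw [riemannZeta_eq_inv_sub_mul hc]
      field_simp [sub_ne_zero.2 hc]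
    rw [this, norm_mul]
    nlinarith
  have hup : ∀ z : ℂ, ‖z‖ ≤ 19 / 10 → ‖riemannZeta₁ (c + z)‖ ≤ 42 * T ^ 2 := by
    intro z hz
    have hre : 1 / 10 ≤ (c + z).re := by
      rw [Complex.add_re, hcre]
      have := (abs_le.1 (Complex.abs_re_le_norm z)).1
      linarith
    have h1 : ‖c + z‖ ≤ 2 * T := by
      refine (norm_add_le _ _).trans ?_
      simp only [T]; linarith [abs_nonneg t]
    have h2 : ‖c + z - 1‖ ≤ 2 * T := by
      rw [add_sub_right_comm]
      refine (norm_add_le _ _).trans ?_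
      have : ‖c - 1‖ ≤ |t| + 1 := by
        have : c - 1 = 1 + t * Complex.I := by simp only [c]; ring
        rw [this]
        refine (norm_add_le _ _).trans ?_
        simp; linarith
      simp only [T]; linarith [abs_nonneg t]
    calc _ ≤ _ := norm_riemannZeta₁_le (by linarith)
      _ ≤ 2 * T + 2 * T * (2 * T) / (1 / 10) := by gcongr
      _ ≤ 42 * T ^ 2 := by nlinarith
  have hlt : ‖riemannZeta₁ (c + 0)‖ < 43 * T ^ 2 := by
    refine (hup 0 (by norm_num)).trans_lt ?_
    nlinarith
  have hne : riemannZeta₁ (c + 0) ≠ 0 := by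
    rw [add_zero]; exact norm_pos_iff.1 (by linarith)
  obtain ⟨N, ρ, h1, h2, h3⟩ := h (fun z ↦ riemannZeta₁ (c + z)) (43 * T ^ 2)
    (differentiable_riemannZeta₁.comp (by fun_prop)) hne hlt
    (fun z hz ↦ (hup z hz.le).trans (by nlinarith))
  have hlog : log (43 * T ^ 2 / ‖riemannZeta₁ (c + 0)‖) ≤ 7 * log T := by
    calc _ ≤ log (43 * T ^ 2 / (1 / 3)) := by
          rw [add_zero]
          gcongr
      _ ≤ log (T ^ 7) := by
          refine Real.log_le_log (by positivity) ?_
          have : 3 ^ 5 ≤ T ^ 5 := by gcongr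
          have h6 : 0 < T ^ 2 := by positivity
          calc 43 * T ^ 2 / (1 / 3) ≤ 3 ^ 5 * T ^ 2 := by linarith
            _ ≤ T ^ 5 * T ^ 2 := by gcongr
            _ = T ^ 7 := by ring
      _ = _ := by rw [Real.log_pow]; norm_num
  have hKlog : K * log (43 * T ^ 2 / ‖riemannZeta₁ (c + 0)‖) ≤ K * 7 * log T := by
    rw [mul_assoc]; gcongr
  refine ⟨N, fun i ↦ c + ρ i, fun i ↦ ⟨(h1 i).1, ?_⟩, h2.trans hKlog, fun s hs hs0 ↦ ?_⟩
  · rw [Complex.add_re, hcre]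
    have := (abs_le.1 (Complex.abs_re_le_norm (ρ i))).1
    linarith [(h1 i).2]
  · have := h3 (s - c) hs (by simpa using hs0)
    refine le_trans (le_of_eq ?_) (this.trans hKlog)
    congr 2
    · rw [logDeriv_apply, logDeriv_apply, deriv_comp_const_add]
      simp
    · refine Finset.sum_congr rfl fun i _ ↦ ?_
      rw [sub_sub]

lemma re_eq_half_of_riemannZeta₁_eq_zero (hRH : RiemannHypothesis) {s : ℂ} (hs : 0 < s.re)
    (h : riemannZeta₁ s = 0) : s.re = 1 / 2 := by
  have h1 : s ≠ 1 := by
    rintro rfl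
    simp [riemannZeta₁_one] at h
  refine hRH s (by rw [riemannZeta_eq_inv_sub_mul h1, h, mul_zero]) ?_ h1
  rintro ⟨n, rfl⟩
  have : (-2 * ((n : ℂ) + 1)).re = -2 * (n + 1) := by simp
  rw [this] at hs
  have : (0 : ℝ) ≤ n := n.cast_nonneg
  linarith

lemma riemannZeta₁_ne_zero_of_half_lt_re (hRH : RiemannHypothesis) {s : ℂ} (hs : 1 / 2 < s.re) :
    riemannZeta₁ s ≠ 0 := fun h ↦
  hs.ne' (re_eq_half_of_riemannZeta₁_eq_zero hRH (by linarith) h)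

lemma exists_norm_logDeriv_riemannZeta₁_le (hRH : RiemannHypothesis) : ∃ K : ℝ, 0 < K ∧
    ∀ δ : ℝ, 0 < δ → δ ≤ 1 → ∀ s : ℂ, 1 / 2 + δ ≤ s.re → s.re ≤ 2 →
      ‖logDeriv riemannZeta₁ s‖ ≤ K * log (|s.im| + 3) / δ := by
  obtain ⟨K, hK, h⟩ := exists_logDeriv_riemannZeta₁_sub_sum_le
  refine ⟨2 * K, by positivity, fun δ hδ hδ1 s hs hs2 ↦ ?_⟩
  obtain ⟨N, ρ, hρ, hN, hb⟩ := h s.im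
  have hlog : 0 < log (|s.im| + 3) := Real.log_pos (by linarith [abs_nonneg s.im])
  have hdist : ‖s - (2 + s.im * Complex.I)‖ ≤ 8 / 5 := by
    have : s - (2 + s.im * Complex.I) = ((s.re - 2 : ℝ) : ℂ) := by
      apply Complex.ext <;> simp
    rw [this, Complex.norm_real, Real.norm_eq_abs, abs_le]
    constructor <;> linarith
  have h1 := hb s hdist (riemannZeta₁_ne_zero_of_half_lt_re hRH (by linarith))
  have h2 : ‖∑ i, 1 / (s - ρ i)‖ ≤ N / δ := by
    calc _ ≤ ∑ _i : Fin N, 1 / δ := by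
          refine norm_sum_le_of_le _ fun i _ ↦ ?_
          rw [norm_div, norm_one]
          refine one_div_le_one_div_of_le hδ (le_trans ?_ (Complex.re_le_norm _))
          rw [Complex.sub_re, re_eq_half_of_riemannZeta₁_eq_zero hRH (hρ i).2 (hρ i).1]
          linarith
      _ = N / δ := by simp [div_eq_mul_inv]
  have h3 := norm_add_le (logDeriv riemannZeta₁ s - ∑ i, 1 / (s - ρ i)) (∑ i, 1 / (s - ρ i))
  rw [sub_add_cancel] at h3
  calc _ ≤ _ := h3
    _ ≤ K * log (|s.im| + 3) / δ + K * log (|s.im| + 3) / δ := by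
        refine add_le_add (h1.trans ?_) (h2.trans (by gcongr))
        rw [le_div_iff₀ hδ]
        exact mul_le_of_le_one_right (by positivity) hδ1
    _ = _ := by ring

lemma integral_div_sq_add_sq_le_pi {δ : ℝ} (hδ : 0 < δ) (a b y : ℝ) :
    ∫ t in a..b, δ / (δ ^ 2 + (t - y) ^ 2) ≤ π := by
  have hd : ∀ t ∈ uIcc a b,
      HasDerivAt (fun t ↦ arctan ((t - y) / δ)) (δ / (δ ^ 2 + (t - y) ^ 2)) t := by
    intro t _
    convert! (((hasDerivAt_id t).sub_const y).div_const δ).arctan using 1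
    simp only [id]
    field_simp
  rw [intervalIntegral.integral_eq_sub_of_hasDerivAt hd]
  · linarith [arctan_lt_pi_div_two ((b - y) / δ), neg_pi_div_two_lt_arctan ((a - y) / δ)]
  · refine Continuous.intervalIntegrable ?_ _ _
    exact continuous_const.div (by fun_prop) fun t ↦ by positivity

lemma exists_integral_abs_re_logDeriv_riemannZeta₁_le (hRH : RiemannHypothesis) :
    ∃ K : ℝ, 0 < K ∧ ∀ δ : ℝ, 0 < δ → δ ≤ 1 → ∀ m : ℝ,
      ∫ t in (m - 1 / 2)..(m + 1 / 2),
        |(logDeriv riemannZeta₁ ((1 / 2 + δ : ℝ) + t * Complex.I)).re| ≤ K * log (|m| + 3) := by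
  obtain ⟨K, hK, h⟩ := exists_logDeriv_riemannZeta₁_sub_sum_le
  refine ⟨(1 + π) * K, by positivity, fun δ hδ hδ1 m ↦ ?_⟩
  obtain ⟨N, ρ, hρ, hN, hb⟩ := h m
  have hlog : 0 < log (|m| + 3) := Real.log_pos (by linarith [abs_nonneg m])
  have hpt : ∀ t ∈ Icc (m - 1 / 2) (m + 1 / 2),
      |(logDeriv riemannZeta₁ ((1 / 2 + δ : ℝ) + t * Complex.I)).re| ≤
        K * log (|m| + 3) + ∑ i, δ / (δ ^ 2 + (t - (ρ i).im) ^ 2) := by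
    intro t ht
    set s : ℂ := (1 / 2 + δ : ℝ) + t * Complex.I
    have hsre : s.re = 1 / 2 + δ := by simp [s]
    have hsim : s.im = t := by simp [s]
    have hdist : ‖s - (2 + m * Complex.I)‖ ≤ 8 / 5 := by
      rw [← abs_of_nonneg (norm_nonneg _), ← abs_of_nonneg (by norm_num : (0 : ℝ) ≤ 8 / 5),
        ← sq_le_sq, Complex.sq_norm, Complex.normSq_apply]
      have e1 : (s - (2 + m * Complex.I)).re = δ - 3 / 2 := by
        simp [hsre]; ring
      have e2 : (s - (2 + m * Complex.I)).im = t - m := by simp [hsim]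
      rw [e1, e2]
      nlinarith [ht.1, ht.2]
    have h1 := hb s hdist (riemannZeta₁_ne_zero_of_half_lt_re hRH (by linarith))
    have h2 : (∑ i, 1 / (s - ρ i)).re = ∑ i, δ / (δ ^ 2 + (t - (ρ i).im) ^ 2) := by
      rw [Complex.re_sum]
      refine Finset.sum_congr rfl fun i _ ↦ ?_
      rw [one_div, Complex.inv_re, Complex.normSq_apply, Complex.sub_re, Complex.sub_im,
        re_eq_half_of_riemannZeta₁_eq_zero hRH (hρ i).2 (hρ i).1, hsre, hsim]
      congr 1 <;> ring
    have h3 := (Complex.abs_re_le_norm _).trans h1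
    rw [Complex.sub_re, h2] at h3
    have h4 : 0 ≤ ∑ i, δ / (δ ^ 2 + (t - (ρ i).im) ^ 2) :=
      Finset.sum_nonneg fun i _ ↦ by positivity
    have h5 := abs_le.1 h3
    exact abs_le.2 ⟨by linarith, by linarith⟩
  have hci : ∀ i, Continuous fun t ↦ δ / (δ ^ 2 + (t - (ρ i).im) ^ 2) := fun i ↦
    continuous_const.div (by fun_prop) fun t ↦ by positivity
  have hcont : Continuous fun t : ℝ ↦
      |(logDeriv riemannZeta₁ ((1 / 2 + δ : ℝ) + t * Complex.I)).re| := by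
    refine (Complex.continuous_re.comp (continuous_iff_continuousAt.2 fun t ↦ ?_)).abs
    have hne := riemannZeta₁_ne_zero_of_half_lt_re hRH
      (s := (1 / 2 + δ : ℝ) + t * Complex.I) (by simp [hδ])
    have : DifferentiableAt ℂ (logDeriv riemannZeta₁) ((1 / 2 + δ : ℝ) + t * Complex.I) :=
      (differentiable_riemannZeta₁.deriv _).div (differentiable_riemannZeta₁ _) hne
    exact this.continuousAt.comp (f := fun t : ℝ ↦ ((1 / 2 + δ : ℝ) + t * Complex.I : ℂ))
      (by fun_prop)
  calc _ ≤ ∫ t in (m - 1 / 2)..(m + 1 / 2),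
        (K * log (|m| + 3) + ∑ i, δ / (δ ^ 2 + (t - (ρ i).im) ^ 2)) := by
        refine intervalIntegral.integral_mono_on (by linarith) (hcont.intervalIntegrable _ _)
          (Continuous.intervalIntegrable ?_ _ _) hpt
        exact continuous_const.add (continuous_finsetSum _ fun i _ ↦ hci i)
    _ = K * log (|m| + 3) + ∑ i, ∫ t in (m - 1 / 2)..(m + 1 / 2),
          δ / (δ ^ 2 + (t - (ρ i).im) ^ 2) := by
        rw [intervalIntegral.integral_add (by simp)
          (Continuous.intervalIntegrable (continuous_finsetSum _ fun i _ ↦ hci i) _ _),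
          intervalIntegral.integral_finsetSum fun i _ ↦ (hci i).intervalIntegrable _ _]
        simp only [intervalIntegral.integral_const, smul_eq_mul]
        ring
    _ ≤ K * log (|m| + 3) + ∑ _i : Fin N, π := by
        gcongr
        exact integral_div_sq_add_sq_le_pi hδ _ _ _
    _ ≤ _ := by
        simp only [Finset.sum_const, Finset.card_univ, Fintype.card_fin, nsmul_eq_mul]
        nlinarith [pi_pos]

end ZetaLogDeriv

section ContourShift
open MeasureTheory

lemma integrable_one_add_sq_rpow : Integrable fun t : ℝ ↦ (1 + t ^ 2) ^ (-(3 / 4) : ℝ) := by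
  have := integrable_rpow_neg_one_add_norm_sq (E := ℝ) (μ := volume) (r := 3 / 2)
    (by simp; norm_num)
  refine this.congr (ae_of_all _ fun t ↦ ?_)
  simp only [Real.norm_eq_abs, sq_abs]
  norm_num

lemma log_abs_add_three_div_le (t : ℝ) :
    log (|t| + 3) / (1 + t ^ 2) ≤ 4 * (1 + t ^ 2) ^ (-(3 / 4) : ℝ) := by
  have hp : 0 < 1 + t ^ 2 := by positivity
  have h1 : log (|t| + 3) ≤ 2 * (|t| + 3) ^ (1 / 2 : ℝ) := by
    have := Real.log_le_rpow_div (x := |t| + 3) (by positivity) (ε := 1 / 2) (by norm_num)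
    linarith
  have h2 : |t| + 3 ≤ 4 * (1 + t ^ 2) ^ (1 / 2 : ℝ) := by
    rw [← Real.sqrt_eq_rpow]
    refine abs_le_of_sq_le_sq' ?_ (by positivity) |>.2
    rw [mul_pow, Real.sq_sqrt hp.le, ← sq_abs t]
    nlinarith [sq_nonneg (|t| - 1)]
  have h3 : (|t| + 3) ^ (1 / 2 : ℝ) ≤ 2 * (1 + t ^ 2) ^ (1 / 4 : ℝ) := by
    calc _ ≤ (4 * (1 + t ^ 2) ^ (1 / 2 : ℝ)) ^ (1 / 2 : ℝ) := by gcongr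
      _ = _ := by
        rw [Real.mul_rpow (by norm_num) (by positivity), ← Real.rpow_mul hp.le,
          show (4 : ℝ) = 2 ^ (2 : ℝ) by norm_num, ← Real.rpow_mul (by norm_num)]
        norm_num
  have h4 : (1 + t ^ 2) ^ (-(3 / 4) : ℝ) = (1 + t ^ 2) ^ (1 / 4 : ℝ) / (1 + t ^ 2) := by
    rw [show (-(3 / 4) : ℝ) = 1 / 4 - 1 by norm_num, Real.rpow_sub_one hp.ne']
  rw [h4, ← mul_div_assoc]
  gcongr
  linarith

lemma integrable_vertical {σ D : ℝ} {Φ : ℂ → ℂ}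
    (hΦ : ∀ s : ℂ, s.re = σ → DifferentiableAt ℂ Φ s)
    (hb : ∀ s : ℂ, s.re = σ → ‖Φ s‖ ≤ D * (1 + s.im ^ 2) ^ (-(3 / 4) : ℝ)) :
    Integrable fun t : ℝ ↦ Φ (σ + t * Complex.I) := by
  refine (integrable_one_add_sq_rpow.const_mul D).mono' (Continuous.aestronglyMeasurable ?_)
    (ae_of_all _ fun t ↦ by simpa using hb (σ + t * Complex.I) (by simp))
  refine continuous_iff_continuousAt.2 fun t ↦ ?_
  exact (hΦ (σ + t * Complex.I) (by simp)).continuousAt.comp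
    (f := fun t : ℝ ↦ (σ + t * Complex.I : ℂ)) (by fun_prop)

lemma integral_vertical_eq {σ₀ σ₁ D : ℝ} (h : σ₀ ≤ σ₁) {Φ : ℂ → ℂ}
    (hΦ : ∀ s : ℂ, s.re ∈ Icc σ₀ σ₁ → DifferentiableAt ℂ Φ s)
    (hb : ∀ s : ℂ, s.re ∈ Icc σ₀ σ₁ → ‖Φ s‖ ≤ D * (1 + s.im ^ 2) ^ (-(3 / 4) : ℝ)) :
    ∫ t : ℝ, Φ (σ₀ + t * Complex.I) = ∫ t : ℝ, Φ (σ₁ + t * Complex.I) := by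
  have hi₀ := integrable_vertical (fun s hs ↦ hΦ s ⟨hs.ge, hs.trans_le h⟩)
    (fun s hs ↦ hb s ⟨hs.ge, hs.trans_le h⟩)
  have hi₁ := integrable_vertical (fun s hs ↦ hΦ s ⟨h.trans_eq hs.symm, hs.le⟩)
    (fun s hs ↦ hb s ⟨h.trans_eq hs.symm, hs.le⟩)
  have hw : Tendsto (fun T : ℝ ↦ D * (1 + T ^ 2) ^ (-(3 / 4) : ℝ) * |σ₁ - σ₀|) atTop (nhds 0) := by
    have h1 : Tendsto (fun T : ℝ ↦ 1 + T ^ 2) atTop atTop :=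
      tendsto_atTop_add_const_left _ _ (tendsto_pow_atTop two_ne_zero)
    have := (((tendsto_rpow_neg_atTop (y := 3 / 4) (by norm_num)).comp h1).const_mul D).mul_const
      |σ₁ - σ₀|
    simpa using this
  have hh : ∀ y : ℝ, ‖∫ x in σ₀..σ₁, Φ (x + y * Complex.I)‖ ≤
      D * (1 + y ^ 2) ^ (-(3 / 4) : ℝ) * |σ₁ - σ₀| := by
    intro y
    refine intervalIntegral.norm_integral_le_of_norm_le_const fun x hx ↦ ?_
    rw [uIoc_of_le h] at hx
    simpa using hb (x + y * Complex.I) (by simpa using ⟨hx.1.le, hx.2⟩)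
  have htop : Tendsto (fun T : ℝ ↦ ∫ x in σ₀..σ₁, Φ (x + T * Complex.I)) atTop (nhds 0) :=
    squeeze_zero_norm hh hw
  have hbot : Tendsto (fun T : ℝ ↦ ∫ x in σ₀..σ₁, Φ (x + (-T : ℝ) * Complex.I)) atTop (nhds 0) :=
    squeeze_zero_norm (fun T ↦ by simpa using hh (-T)) hw
  have hv : ∀ σ : ℝ, Integrable (fun t : ℝ ↦ Φ (σ + t * Complex.I)) →
      Tendsto (fun T : ℝ ↦ ∫ t in (-T)..T, Φ (σ + t * Complex.I)) atTop
        (nhds (∫ t : ℝ, Φ (σ + t * Complex.I))) := fun σ hi ↦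
    intervalIntegral_tendsto_integral hi tendsto_neg_atTop_atBot tendsto_id
  have hlim := ((hbot.sub htop).add ((hv σ₁ hi₁).const_smul Complex.I)).sub
    ((hv σ₀ hi₀).const_smul Complex.I)
  have hzero : ∀ T : ℝ, (∫ x in σ₀..σ₁, Φ (x + (-T : ℝ) * Complex.I)) -
      (∫ x in σ₀..σ₁, Φ (x + T * Complex.I)) +
      Complex.I • (∫ t in (-T)..T, Φ (σ₁ + t * Complex.I)) -
      Complex.I • (∫ t in (-T)..T, Φ (σ₀ + t * Complex.I)) = 0 := by
    intro T
    have := Complex.integral_boundary_rect_eq_zero_of_differentiableOn Φ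
      (σ₀ + (-T : ℝ) * Complex.I) (σ₁ + T * Complex.I) ?_
    · simpa using this
    · intro s hs
      rw [Complex.mem_reProdIm] at hs
      have h1 := hs.1
      simp only [Complex.add_re, Complex.ofReal_re, Complex.mul_re, Complex.I_re, mul_zero,
        Complex.ofReal_im, Complex.I_im, sub_self, add_zero, uIcc_of_le h, mul_one] at h1
      exact (hΦ s h1).differentiableWithinAt
  have h0 := tendsto_nhds_unique hlim ((tendsto_congr hzero).2 tendsto_const_nhds)
  simp only [sub_zero, zero_add, ← smul_sub] at h0
  exact (sub_eq_zero.1 ((smul_eq_zero.1 h0).resolve_left Complex.I_ne_zero)).symm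

end ContourShift

section MellinPsi
open MeasureTheory

lemma integrableOn_mul_cpow_of_abs_le {R : ℝ → ℝ} (hR : Measurable R) {C : ℝ}
    (hC : ∀ u, 1 < u → |R u| ≤ C * u) {s : ℂ} (hs : 1 < s.re) :
    IntegrableOn (fun u : ℝ ↦ (R u : ℂ) * (u : ℂ) ^ (-(s + 1))) (Ioi 1) := by
  have hi : IntegrableOn (fun u : ℝ ↦ C * u ^ (-s.re)) (Ioi 1) :=
    (integrableOn_Ioi_rpow_of_lt (by linarith) zero_lt_one).const_mul C
  refine hi.mono' (Measurable.aestronglyMeasurable (by fun_prop)) ?_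
  refine (ae_restrict_mem measurableSet_Ioi).mono fun u hu ↦ ?_
  have hu0 : (0 : ℝ) < u := zero_lt_one.trans hu
  rw [norm_mul, Complex.norm_real, Complex.norm_cpow_eq_rpow_re_of_pos hu0]
  calc |R u| * u ^ (-(s + 1)).re ≤ C * u * u ^ (-(s + 1)).re := by gcongr; exact hC u hu
    _ = C * u ^ (-s.re) := by
      rw [mul_assoc, ← Real.rpow_one_add' hu0.le]
      · simp
      · simp; linarith

lemma integral_primitive_mul_cpow {R : ℝ → ℝ} (hR : Measurable R) {C : ℝ}
    (hC : ∀ u, 1 < u → |R u| ≤ C * u) {s : ℂ} (hs : 1 < s.re) :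
    ∫ y in Ioi (1 : ℝ), ((∫ u in (1 : ℝ)..y, R u : ℝ) : ℂ) * (y : ℂ) ^ (-(s + 2)) =
      (∫ u in Ioi (1 : ℝ), (R u : ℂ) * (u : ℂ) ^ (-(s + 1))) / (s + 1) := by
  set f : ℝ → ℝ → ℂ := fun y u ↦ (Iic y).indicator (fun u ↦ (R u : ℂ) * (y : ℂ) ^ (-(s + 2))) u
  have hf' : ∀ y u, f y u = (Ici u).indicator (fun y ↦ (R u : ℂ) * (y : ℂ) ^ (-(s + 2))) y := by
    intro y u
    simp [f, indicator]
  have hs2 : (-(s + 2)).re < -1 := by simp; linarith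
  have hs1 : s + 1 ≠ 0 := fun h ↦ by
    have := congrArg Complex.re h
    simp at this; linarith
  have hfm : Measurable (Function.uncurry f) := by
    have : Function.uncurry f = {p : ℝ × ℝ | p.2 ≤ p.1}.indicator
        fun p ↦ (R p.2 : ℂ) * (p.1 : ℂ) ^ (-(s + 2)) := by
      ext ⟨y, u⟩
      simp [f, indicator, Function.uncurry]
    rw [this]
    refine Measurable.indicator ?_ (measurableSet_le measurable_snd measurable_fst)
    fun_prop
  have hcap : ∀ u : ℝ, 1 < u → Ioi (1 : ℝ) ∩ Ici u = Ici u := fun u hu ↦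
    inter_eq_right.2 fun y hy ↦ lt_of_lt_of_le hu hy
  have hint : Integrable (Function.uncurry f)
      ((volume.restrict (Ioi 1)).prod (volume.restrict (Ioi 1))) := by
    rw [integrable_prod_iff' hfm.aestronglyMeasurable]
    constructor
    · refine ae_of_all _ fun u ↦ ?_
      simp only [Function.uncurry, hf']
      exact ((integrableOn_Ioi_cpow_of_lt hs2 zero_lt_one).const_mul _).indicator measurableSet_Ici
    · have h1 := (integrableOn_mul_cpow_of_abs_le hR hC hs).norm.div_const (s.re + 1)
      refine h1.congr ((ae_restrict_mem measurableSet_Ioi).mono fun u hu ↦ ?_)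
      have hu0 : (0 : ℝ) < u := zero_lt_one.trans hu
      simp only [Function.uncurry, hf', norm_indicator_eq_indicator_norm]
      rw [setIntegral_indicator measurableSet_Ici, hcap u hu, integral_Ici_eq_integral_Ioi]
      have : ∀ y ∈ Ioi u, ‖(R u : ℂ) * (y : ℂ) ^ (-(s + 2))‖ = |R u| * y ^ (-(s.re + 2)) := by
        intro y hy
        rw [norm_mul, Complex.norm_real, Complex.norm_cpow_eq_rpow_re_of_pos (hu0.trans hy)]
        simp
      rw [setIntegral_congr_fun measurableSet_Ioi this, integral_const_mul,
        integral_Ioi_rpow_of_lt (by linarith) hu0, norm_mul, Complex.norm_real,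
        Complex.norm_cpow_eq_rpow_re_of_pos hu0, mul_div_assoc]
      simp only [Complex.neg_re, Complex.add_re, Complex.one_re, Real.norm_eq_abs]
      rw [show -(s.re + 2) + 1 = -(s.re + 1) by ring, neg_div_neg_eq]
  have hL : ∀ y ∈ Ioi (1 : ℝ), ((∫ u in (1 : ℝ)..y, R u : ℝ) : ℂ) * (y : ℂ) ^ (-(s + 2)) =
      ∫ u in Ioi 1, f y u := by
    intro y hy
    rw [setIntegral_indicator measurableSet_Iic, Ioi_inter_Iic, integral_mul_const,
      intervalIntegral.integral_of_le (le_of_lt hy), ← integral_complex_ofReal]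
  rw [setIntegral_congr_fun measurableSet_Ioi hL, integral_integral_swap hint, ← integral_div]
  refine setIntegral_congr_fun measurableSet_Ioi fun u hu ↦ ?_
  have hu0 : (0 : ℝ) < u := zero_lt_one.trans hu
  simp only [hf']
  rw [setIntegral_indicator measurableSet_Ici, hcap u hu, integral_Ici_eq_integral_Ioi,
    integral_const_mul, integral_Ioi_cpow_of_lt hs2 hu0, mul_div_assoc,
    show -(s + 2) + 1 = -(s + 1) by ring, neg_div_neg_eq]

lemma measurable_psi_sub_self : Measurable fun y ↦ Chebyshev.psi y - y :=
  Chebyshev.psi_mono.measurable.sub measurable_id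

lemma abs_psi_sub_self_le {y : ℝ} (hy : 0 ≤ y) : |Chebyshev.psi y - y| ≤ (log 4 + 4) * y := by
  have h1 := Chebyshev.psi_le_const_mul_self hy
  have h2 := Chebyshev.psi_nonneg y
  have h4 : 0 ≤ log 4 := Real.log_nonneg (by norm_num)
  rw [abs_le]
  constructor <;> nlinarith

/-- The function `-ζ'/ζ(s) - s/(s-1)`, without its removable singularity at `s = 1`. -/
noncomputable def zetaErr (s : ℂ) : ℂ := -logDeriv riemannZeta₁ s - 1

lemma zetaErr_eq_mul_integral {s : ℂ} (hs : 1 < s.re) :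
    zetaErr s = s * ∫ u in Ioi (1 : ℝ), ((Chebyshev.psi u - u : ℝ) : ℂ) * (u : ℂ) ^ (-(s + 1)) := by
  have hs1 : s ≠ 1 := fun h ↦ by simp [h] at hs
  have hs1' : s - 1 ≠ 0 := sub_ne_zero.2 hs1
  have hsum : ∀ t : ℝ, ∑ k ∈ Finset.Icc 1 ⌊t⌋₊, ArithmeticFunction.vonMangoldt k =
      Chebyshev.psi t := fun t ↦ rfl
  have hL := LSeries_eq_mul_integral_of_nonneg (fun n ↦ ArithmeticFunction.vonMangoldt n)
    zero_le_one hs (by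
      refine Asymptotics.IsBigO.of_bound (log 4 + 4) (Eventually.of_forall fun n ↦ ?_)
      have := hsum n
      rw [Nat.floor_natCast] at this
      rw [this, Real.norm_eq_abs, abs_of_nonneg (Chebyshev.psi_nonneg _)]
      simpa using Chebyshev.psi_le_const_mul_self n.cast_nonneg)
    (fun _ ↦ ArithmeticFunction.vonMangoldt_nonneg)
  have hzne : riemannZeta s ≠ 0 := riemannZeta_ne_zero_of_one_le_re hs.le
  have hld : logDeriv riemannZeta₁ s = 1 / (s - 1) + deriv riemannZeta s / riemannZeta s := by
    have hev : riemannZeta₁ =ᶠ[nhds s] fun z ↦ (z - 1) * riemannZeta z := by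
      filter_upwards [isOpen_ne.mem_nhds hs1] with z hz
      rw [riemannZeta_eq_inv_sub_mul hz]
      field_simp [sub_ne_zero.2 hz]
    rw [logDeriv_apply, hev.deriv_eq, hev.eq_of_nhds, ← logDeriv_apply,
      logDeriv_mul s hs1' hzne (by fun_prop) (differentiableAt_riemannZeta hs1)]
    simp [logDeriv_apply]
  have hpsi : ∫ t in Ioi (1 : ℝ), (∑ k ∈ Finset.Icc 1 ⌊t⌋₊,
        ((ArithmeticFunction.vonMangoldt k : ℝ) : ℂ)) * (t : ℂ) ^ (-(s + 1)) =
      (∫ u in Ioi (1 : ℝ), ((Chebyshev.psi u - u : ℝ) : ℂ) * (u : ℂ) ^ (-(s + 1))) +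
        ∫ u in Ioi (1 : ℝ), (u : ℂ) ^ (-s) := by
    rw [← integral_add (integrableOn_mul_cpow_of_abs_le measurable_psi_sub_self
      (fun u hu ↦ abs_psi_sub_self_le (zero_le_one.trans hu.le)) hs)
      (integrableOn_Ioi_cpow_of_lt (by simpa using hs) zero_lt_one)]
    refine setIntegral_congr_fun measurableSet_Ioi fun u hu ↦ ?_
    have hu0 : (0 : ℝ) < u := zero_lt_one.trans hu
    have hu' : (u : ℂ) ≠ 0 := by exact_mod_cast hu0.ne'
    have : (u : ℂ) ^ (-s) = u * (u : ℂ) ^ (-(s + 1)) := by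
      nth_rw 2 [← Complex.cpow_one (u : ℂ)]
      rw [← Complex.cpow_add _ _ hu']; ring_nf
    have h2 : (∑ k ∈ Finset.Icc 1 ⌊u⌋₊, ((ArithmeticFunction.vonMangoldt k : ℝ) : ℂ)) =
        (Chebyshev.psi u : ℂ) := by
      rw [← hsum u]; push_cast; rfl
    simp only [this, h2]
    push_cast
    ring
  rw [ArithmeticFunction.LSeries_vonMangoldt_eq_deriv_riemannZeta_div hs, hpsi, mul_add,
    integral_Ioi_cpow_of_lt (by simpa using hs) zero_lt_one] at hL
  rw [zetaErr, hld, ← sub_eq_iff_eq_add.2 hL]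
  have h3 : -s + 1 ≠ 0 := fun h ↦ hs1' (by linear_combination -h)
  simp only [Complex.ofReal_one, Complex.one_cpow]
  rw [show -s + 1 = -(s - 1) by ring, neg_div_neg_eq]
  field_simp
  ring

end MellinPsi

section PerronFormula
open MeasureTheory

lemma exists_norm_zetaErr_le (hRH : RiemannHypothesis) : ∃ K : ℝ, 0 < K ∧
    ∀ δ : ℝ, 0 < δ → δ ≤ 1 → ∀ s : ℂ, 1 / 2 + δ ≤ s.re → s.re ≤ 2 →
      ‖zetaErr s‖ ≤ K / δ * log (|s.im| + 3) := by
  obtain ⟨K, hK, h⟩ := exists_norm_logDeriv_riemannZeta₁_le hRH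
  refine ⟨K + 1, by positivity, fun δ hδ hδ1 s hs hs2 ↦ ?_⟩
  have hlog : 1 ≤ log (|s.im| + 3) := by
    rw [Real.le_log_iff_exp_le (by positivity)]
    linarith [Real.exp_one_lt_d9, abs_nonneg s.im]
  have h1 : (1 : ℝ) ≤ 1 / δ * log (|s.im| + 3) :=
    one_le_mul_of_one_le_of_one_le ((one_le_div hδ).2 hδ1) hlog
  calc ‖zetaErr s‖ ≤ ‖logDeriv riemannZeta₁ s‖ + 1 := by
        refine (norm_sub_le _ _).trans (by simp)
    _ ≤ K * log (|s.im| + 3) / δ + 1 / δ * log (|s.im| + 3) := add_le_add (h δ hδ hδ1 s hs hs2) h1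
    _ = _ := by ring

lemma differentiableAt_zetaErr (hRH : RiemannHypothesis) {s : ℂ} (hs : 1 / 2 < s.re) :
    DifferentiableAt ℂ zetaErr s := by
  have : DifferentiableAt ℂ (logDeriv riemannZeta₁) s :=
    (differentiable_riemannZeta₁.deriv s).div (differentiable_riemannZeta₁ s)
      (riemannZeta₁_ne_zero_of_half_lt_re hRH hs)
  exact this.neg.sub_const 1

lemma riemannZeta₁_conj (s : ℂ) :
    riemannZeta₁ (starRingEnd ℂ s) = starRingEnd ℂ (riemannZeta₁ s) := by
  by_cases hs : s = 1
  · simp [hs, riemannZeta₁_one]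
  · have hs' : starRingEnd ℂ s ≠ 1 := fun h ↦ hs (by simpa using congrArg (starRingEnd ℂ) h)
    have h1 : ∀ w : ℂ, w ≠ 1 → riemannZeta₁ w = (w - 1) * riemannZeta w := fun w hw ↦ by
      rw [riemannZeta_eq_inv_sub_mul hw]
      field_simp [sub_ne_zero.2 hw]
    rw [h1 _ hs', h1 _ hs, riemannZeta_conj, map_mul, map_sub, map_one]

lemma zetaErr_conj (s : ℂ) : zetaErr (starRingEnd ℂ s) = starRingEnd ℂ (zetaErr s) := by
  have h : (starRingEnd ℂ) ∘ riemannZeta₁ ∘ (starRingEnd ℂ) = riemannZeta₁ := by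
    ext s
    simp [riemannZeta₁_conj]
  have hd : deriv riemannZeta₁ (starRingEnd ℂ s) = starRingEnd ℂ (deriv riemannZeta₁ s) := by
    conv_lhs => rw [← h]
    rw [deriv_conj_conj]
    simp
  simp [zetaErr, logDeriv_apply, riemannZeta₁_conj, hd]

/-- The kernel `a ^ (w + 1) / (w * (w + 1))` of the once integrated Perron formula. -/
noncomputable def perronKernel (a : ℝ) (w : ℂ) : ℂ := (a : ℂ) ^ (w + 1) / (w * (w + 1))

lemma mul_one_add_sq_le_norm_mul {η : ℝ} (hη : 0 < η) (hη1 : η ≤ 1) {w : ℂ} (hw : η ≤ w.re) :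
    η * (1 + w.im ^ 2) ≤ ‖w * (w + 1)‖ := by
  have hre : 0 < w.re := hη.trans_le hw
  have hs : √(1 + w.im ^ 2) * √(1 + w.im ^ 2) = 1 + w.im ^ 2 := Real.mul_self_sqrt (by positivity)
  have h1 : η * √(1 + w.im ^ 2) ≤ ‖w‖ := by
    refine abs_le_of_sq_le_sq' ?_ (norm_nonneg _) |>.2
    rw [mul_pow, Real.sq_sqrt (by positivity), Complex.sq_norm, Complex.normSq_apply]
    nlinarith [sq_nonneg w.im, mul_nonneg (sub_nonneg.2 hη1) (sq_nonneg w.im)]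
  have h2 : √(1 + w.im ^ 2) ≤ ‖w + 1‖ := by
    refine abs_le_of_sq_le_sq' ?_ (norm_nonneg _) |>.2
    rw [Real.sq_sqrt (by positivity), Complex.sq_norm, Complex.normSq_apply]
    simp only [Complex.add_re, Complex.one_re, Complex.add_im, Complex.one_im, add_zero]
    nlinarith
  rw [norm_mul, ← hs, ← mul_assoc]
  gcongr

lemma norm_perronKernel_le {a η : ℝ} (ha : 0 < a) (hη : 0 < η) (hη1 : η ≤ 1) {w : ℂ}
    (hw : η ≤ w.re) : ‖perronKernel a w‖ ≤ a ^ (w.re + 1) / (η * (1 + w.im ^ 2)) := by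
  rw [perronKernel, norm_div, Complex.norm_cpow_eq_rpow_re_of_pos ha]
  have := mul_one_add_sq_le_norm_mul hη hη1 hw
  simp only [Complex.add_re, Complex.one_re]
  gcongr

lemma norm_mul_perronKernel_le {a η B t : ℝ} (ha : 0 < a) (hη : 0 < η) (hη1 : η ≤ 1)
    {w Z : ℂ} (hw : η ≤ w.re) (hB : 0 ≤ B) (ht : w.im ^ 2 = t ^ 2)
    (hZ : ‖Z‖ ≤ B * log (|t| + 3)) :
    ‖Z * perronKernel a w‖ ≤ 4 * B * a ^ (w.re + 1) / η * (1 + t ^ 2) ^ (-(3 / 4) : ℝ) := by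
  have hlog : 0 ≤ log (|t| + 3) := Real.log_nonneg (by linarith [abs_nonneg t])
  calc _ ≤ B * log (|t| + 3) * (a ^ (w.re + 1) / (η * (1 + t ^ 2))) := by
        rw [norm_mul, ← ht]
        gcongr
        exact norm_perronKernel_le ha hη hη1 hw
    _ = B * a ^ (w.re + 1) / η * (log (|t| + 3) / (1 + t ^ 2)) := by field_simp
    _ ≤ B * a ^ (w.re + 1) / η * (4 * (1 + t ^ 2) ^ (-(3 / 4) : ℝ)) := by
        gcongr
        exact log_abs_add_three_div_le t
    _ = _ := by ring

lemma differentiableAt_perronKernel {a : ℝ} (ha : 0 < a) {w : ℂ} (hw : 0 < w.re) :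
    DifferentiableAt ℂ (perronKernel a) w := by
  have h0 : w ≠ 0 := fun h ↦ by simp [h] at hw
  have h1 : w + 1 ≠ 0 := fun h ↦ by
    have := congrArg Complex.re h
    simp at this; linarith
  have ha' : (a : ℂ) ≠ 0 := by exact_mod_cast ha.ne'
  exact ((differentiableAt_id.add_const 1).const_cpow (Or.inl ha')).div
    (differentiableAt_id.mul (differentiableAt_id.add_const 1)) (mul_ne_zero h0 h1)

/-- The integral of `ψ(y) - y` over `[1, a]`. -/
noncomputable def psiErrPrimitive (a : ℝ) : ℝ := ∫ y in (1 : ℝ)..a, (Chebyshev.psi y - y)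

lemma intervalIntegrable_psi_sub_self (a b : ℝ) :
    IntervalIntegrable (fun y ↦ Chebyshev.psi y - y) volume a b :=
  Chebyshev.psi_mono.intervalIntegrable.sub (continuous_id.intervalIntegrable a b)

lemma continuous_psiErrPrimitive : Continuous psiErrPrimitive :=
  intervalIntegral.continuous_primitive intervalIntegrable_psi_sub_self 1

lemma abs_psiErrPrimitive_le {a : ℝ} (ha : 1 ≤ a) :
    |psiErrPrimitive a| ≤ (log 4 + 4) * a ^ 2 := by
  have h4 : 0 ≤ log 4 := Real.log_nonneg (by norm_num)
  have := intervalIntegral.norm_integral_le_of_norm_le_const (a := 1) (b := a)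
    (f := fun y ↦ Chebyshev.psi y - y) (C := (log 4 + 4) * a) fun y hy ↦ by
      rw [uIoc_of_le ha] at hy
      exact (abs_psi_sub_self_le (zero_le_one.trans hy.1.le)).trans (by gcongr; exact hy.2)
  rw [psiErrPrimitive, ← Real.norm_eq_abs]
  refine this.trans ?_
  rw [abs_of_nonneg (by linarith), sq, ← mul_assoc]
  gcongr
  linarith

lemma mellin_psiErrPrimitive {s : ℂ} (hs : 1 < s.re) :
    mellin ((Ioi (1 : ℝ)).indicator fun y ↦ (psiErrPrimitive y : ℂ)) (-(s + 1)) =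
      zetaErr s / (s * (s + 1)) := by
  have hs0 : s ≠ 0 := fun h ↦ by simp [h] at hs; linarith
  have h := integral_primitive_mul_cpow measurable_psi_sub_self
    (fun u hu ↦ abs_psi_sub_self_le (zero_le_one.trans hu.le)) hs
  rw [zetaErr_eq_mul_integral hs, mul_div_mul_left _ _ hs0, ← h, mellin,
    ← integral_indicator measurableSet_Ioi, ← integral_indicator measurableSet_Ioi]
  congr 1
  ext t
  by_cases ht : t ∈ Ioi (1 : ℝ)
  · have h0 : t ∈ Ioi (0 : ℝ) := mem_Ioi.2 (zero_lt_one.trans ht)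
    simp only [indicator_of_mem ht, indicator_of_mem h0, smul_eq_mul]
    rw [mul_comm, psiErrPrimitive]
    ring_nf
  · simp [indicator_of_notMem ht]

lemma mellinConvergent_psiErrPrimitive {s : ℂ} (hs : 1 < s.re) :
    MellinConvergent ((Ioi (1 : ℝ)).indicator fun y ↦ (psiErrPrimitive y : ℂ)) (-(s + 1)) := by
  have hm : Measurable ((Ioi (1 : ℝ)).indicator fun y ↦ (psiErrPrimitive y : ℂ)) :=
    (Complex.continuous_ofReal.comp continuous_psiErrPrimitive).measurable.indicator
      measurableSet_Ioi
  have hi' : IntegrableOn (fun y : ℝ ↦ (log 4 + 4) * y ^ (-s.re)) (Ioi 1) :=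
    (integrableOn_Ioi_rpow_of_lt (by linarith) zero_lt_one).const_mul _
  have hi := hi'.integrable_indicator measurableSet_Ioi
  refine hi.integrableOn.mono' (Measurable.aestronglyMeasurable (by fun_prop)) (ae_of_all _ fun y ↦ ?_)
  by_cases hy : y ∈ Ioi (1 : ℝ)
  · have hy0 : (0 : ℝ) < y := zero_lt_one.trans hy
    rw [indicator_of_mem hy, indicator_of_mem hy, norm_smul, Complex.norm_real,
      Complex.norm_cpow_eq_rpow_re_of_pos hy0]
    calc _ ≤ y ^ (-(s + 1) - 1).re * ((log 4 + 4) * y ^ 2) := by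
          gcongr; exact abs_psiErrPrimitive_le (le_of_lt hy)
      _ = (log 4 + 4) * (y ^ (-(s + 1) - 1).re * y ^ (2 : ℝ)) := by norm_cast; ring
      _ = _ := by
          rw [← Real.rpow_add hy0]
          congr 2
          simp; ring
  · simp [indicator_of_notMem hy]

lemma psiErrPrimitive_eq_integral_two (hRH : RiemannHypothesis) {a : ℝ} (ha : 1 < a) :
    (psiErrPrimitive a : ℂ) = (1 / (2 * π) : ℝ) •
      ∫ t : ℝ, zetaErr ((2 : ℝ) + t * Complex.I) * perronKernel a ((2 : ℝ) + t * Complex.I) := by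
  set F := (Ioi (1 : ℝ)).indicator fun y ↦ (psiErrPrimitive y : ℂ)
  have ha0 : 0 < a := by linarith
  have hmel : ∀ t : ℝ, mellin F (((-3 : ℝ) : ℂ) + t * Complex.I) =
      zetaErr ((2 : ℝ) + (-t : ℝ) * Complex.I) / (((2 : ℝ) + (-t : ℝ) * Complex.I) *
        ((2 : ℝ) + (-t : ℝ) * Complex.I + 1)) := by
    intro t
    rw [← mellin_psiErrPrimitive (by simp)]
    congr 1
    push_cast; ring
  have hprod : ∀ t : ℝ, (a : ℂ) ^ (-(((-3 : ℝ) : ℂ) + t * Complex.I)) •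
      mellin F (((-3 : ℝ) : ℂ) + t * Complex.I) = zetaErr ((2 : ℝ) + (-t : ℝ) * Complex.I) *
        perronKernel a ((2 : ℝ) + (-t : ℝ) * Complex.I) := by
    intro t
    rw [hmel, perronKernel, smul_eq_mul, mul_div_assoc', mul_div_assoc', mul_comm]
    congr 3
    push_cast; ring
  obtain ⟨K, hK, hb⟩ := exists_norm_zetaErr_le hRH
  have hvi : Complex.VerticalIntegrable (mellin F) (-3) := by
    have h1 := integrable_vertical (σ := 2) (D := 4 * K * 1 ^ ((2 : ℝ) + 1) / 1)
      (Φ := fun s ↦ zetaErr s * perronKernel 1 s)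
      (fun s hs ↦ (differentiableAt_zetaErr hRH (by rw [hs]; norm_num)).mul
        (differentiableAt_perronKernel one_pos (by rw [hs]; norm_num)))
      (fun s hs ↦ by
        rw [← hs]
        refine norm_mul_perronKernel_le one_pos one_pos le_rfl (by rw [hs]; norm_num) hK.le rfl ?_
        simpa using hb 1 one_pos le_rfl s (by rw [hs]; norm_num) hs.le)
    refine h1.comp_neg.congr (ae_of_all _ fun t ↦ ?_)
    simp only [hmel, perronKernel, Complex.ofReal_one, Complex.one_cpow]
    ring
  have hinv := mellinInv_mellin_eq (-3) F ha0 (by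
      have := mellinConvergent_psiErrPrimitive (s := 2) (by simp)
      convert this using 1
      push_cast; norm_num) hvi (by
      have : F =ᶠ[nhds a] fun y ↦ (psiErrPrimitive y : ℂ) := by
        filter_upwards [Ioi_mem_nhds ha] with y hy
        exact indicator_of_mem hy _
      refine ContinuousAt.congr ?_ this.symm
      exact (Complex.continuous_ofReal.comp continuous_psiErrPrimitive).continuousAt)
  rw [mellinInv] at hinv
  simp_rw [hprod] at hinv
  rw [integral_neg_eq_self (μ := volume) (fun t : ℝ ↦ zetaErr ((2 : ℝ) + t * Complex.I) *
        perronKernel a ((2 : ℝ) + t * Complex.I))] at hinv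
  rw [hinv]
  simp [F, indicator_of_mem (mem_Ioi.2 ha)]

end PerronFormula

section LocalSums
open MeasureTheory

lemma summable_one_div_nat_add_one_rpow {ε : ℝ} (hε : 0 < ε) :
    Summable fun n : ℕ ↦ 1 / ((n : ℝ) + 1) ^ (1 + ε) := by
  have := (summable_nat_add_iff 1).2 (Real.summable_one_div_nat_rpow.2 (by linarith : 1 < 1 + ε))
  simpa using this

lemma riemannZeta_one_add_eq_tsum {ε : ℝ} (hε : 0 < ε) :
    riemannZeta ((1 + ε : ℝ) : ℂ) = ((∑' n : ℕ, 1 / ((n : ℝ) + 1) ^ (1 + ε) : ℝ) : ℂ) := by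
  rw [zeta_eq_tsum_one_div_nat_add_one_cpow (by simpa using hε), Complex.ofReal_tsum]
  refine tsum_congr fun n ↦ ?_
  rw [Complex.ofReal_div, Complex.ofReal_cpow (by positivity)]
  push_cast
  rfl

lemma tsum_one_div_nat_add_one_rpow_le {ε : ℝ} (hε : 0 < ε) (hε1 : ε ≤ 1) :
    ∑' n : ℕ, 1 / ((n : ℝ) + 1) ^ (1 + ε) ≤ 4 / ε := by
  have h1 : ((1 + ε : ℝ) : ℂ) ≠ 1 := by
    norm_cast; linarith
  have h2 : ‖riemannZeta₁ ((1 + ε : ℝ) : ℂ)‖ ≤ 4 := by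
    refine (norm_riemannZeta₁_le (by simp; linarith)).trans ?_
    rw [← Complex.ofReal_one, ← Complex.ofReal_sub, Complex.norm_real, Complex.norm_real,
      Complex.ofReal_re, Real.norm_of_nonneg (by linarith), Real.norm_of_nonneg (by linarith),
      mul_div_cancel_left₀ _ (by linarith)]
    linarith
  calc _ ≤ ‖riemannZeta ((1 + ε : ℝ) : ℂ)‖ := by
        rw [riemannZeta_one_add_eq_tsum hε, Complex.norm_real]
        exact Real.le_norm_self _
    _ = ε⁻¹ * ‖riemannZeta₁ ((1 + ε : ℝ) : ℂ)‖ := by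
        rw [riemannZeta_eq_inv_sub_mul h1, norm_mul, norm_inv, ← Complex.ofReal_one,
          ← Complex.ofReal_sub, Complex.norm_real, Real.norm_of_nonneg (by linarith)]
        ring
    _ ≤ ε⁻¹ * 4 := by gcongr
    _ = 4 / ε := by ring

lemma one_add_sq_rpow_le {ε : ℝ} (hε : 0 < ε) {x : ℝ} (hx : 0 < x) :
    (1 + x ^ 2) ^ (-((1 + ε) / 2)) ≤ 1 / x ^ (1 + ε) := by
  calc _ ≤ (x ^ 2) ^ (-((1 + ε) / 2)) :=
        Real.rpow_le_rpow_of_nonpos (by positivity) (by linarith) (by linarith)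
    _ = _ := by
        rw [← Real.rpow_natCast, ← Real.rpow_mul hx.le, one_div, ← Real.rpow_neg hx.le]
        congr 1
        push_cast; ring

lemma summable_int_of_even {g : ℤ → ℝ} (hg : ∀ n, g (-n) = g n) {A : ℝ}
    (hs : Summable fun n : ℕ ↦ g (n + 1)) (hA : ∑' n : ℕ, g (n + 1) ≤ A) :
    Summable g ∧ ∑' n, g n ≤ g 0 + A + A := by
  have hs2 : Summable fun n : ℕ ↦ g n := by
    refine (summable_nat_add_iff 1).1 ?_
    simpa using hs
  have hs3 : Summable fun n : ℕ ↦ g (-(n + 1)) := by simpa only [hg] using hs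
  refine ⟨Summable.of_nat_of_neg_add_one hs2 hs3, ?_⟩
  rw [tsum_of_nat_of_neg_add_one hs2 hs3, hs2.tsum_eq_zero_add]
  simp only [hg, Nat.cast_add, Nat.cast_one, Nat.cast_zero]
  linarith

lemma summable_int_one_add_sq_rpow {ε : ℝ} (hε : 0 < ε) (hε1 : ε ≤ 1) :
    Summable (fun n : ℤ ↦ (1 + (n : ℝ) ^ 2) ^ (-((1 + ε) / 2))) ∧
      ∑' n : ℤ, (1 + (n : ℝ) ^ 2) ^ (-((1 + ε) / 2)) ≤ 9 / ε := by
  have hs := summable_one_div_nat_add_one_rpow hε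
  have hz := tsum_one_div_nat_add_one_rpow_le hε hε1
  have hle : ∀ n : ℕ, (1 + ((n : ℝ) + 1) ^ 2) ^ (-((1 + ε) / 2)) ≤ 1 / ((n : ℝ) + 1) ^ (1 + ε) :=
    fun n ↦ one_add_sq_rpow_le hε (by positivity)
  have hs1 : Summable fun n : ℕ ↦ (1 + ((n : ℝ) + 1) ^ 2) ^ (-((1 + ε) / 2)) :=
    Summable.of_nonneg_of_le (fun n ↦ by positivity) hle hs
  have ht1 := (hs1.tsum_le_tsum hle hs).trans hz
  obtain ⟨h1, h2⟩ := summable_int_of_even (g := fun n : ℤ ↦ (1 + (n : ℝ) ^ 2) ^ (-((1 + ε) / 2)))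
    (fun n ↦ by push_cast; rw [neg_sq]) (A := 4 / ε) (by push_cast; exact hs1)
    (by push_cast; exact ht1)
  refine ⟨h1, h2.trans ?_⟩
  have e4 : 1 ≤ 1 / ε := (one_le_div hε).2 hε1
  have e5 : (1 + ((0 : ℤ) : ℝ) ^ 2) ^ (-((1 + ε) / 2)) = 1 := by simp
  calc _ ≤ 1 / ε + 4 / ε + 4 / ε := by
        gcongr
        exact e5.le.trans e4
    _ = 9 / ε := by ring

lemma log_abs_add_three_mul_le {θ : ℝ} (hθ : 0 < θ) (hθ1 : θ ≤ 1) (x : ℝ) :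
    log (|x| + 3) * (1 + x ^ 2) ^ (-((1 + θ) / 2)) ≤
      8 / θ * (1 + x ^ 2) ^ (-((1 + θ / 2) / 2)) := by
  have hp : 0 < 1 + x ^ 2 := by positivity
  have h1 := Real.log_le_rpow_div (x := |x| + 3) (by positivity) (ε := θ / 2) (by positivity)
  have h2 : |x| + 3 ≤ 4 * (1 + x ^ 2) ^ (1 / 2 : ℝ) := by
    rw [← Real.sqrt_eq_rpow]
    refine abs_le_of_sq_le_sq' ?_ (by positivity) |>.2
    rw [mul_pow, Real.sq_sqrt hp.le, ← sq_abs x]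
    nlinarith [sq_nonneg (|x| - 1)]
  have h3 : (|x| + 3) ^ (θ / 2) ≤ 4 * (1 + x ^ 2) ^ (θ / 4) := by
    calc _ ≤ (4 * (1 + x ^ 2) ^ (1 / 2 : ℝ)) ^ (θ / 2) := by gcongr
      _ = 4 ^ (θ / 2) * (1 + x ^ 2) ^ (θ / 4) := by
        rw [Real.mul_rpow (by norm_num) (by positivity), ← Real.rpow_mul hp.le]
        ring_nf
      _ ≤ 4 ^ (1 : ℝ) * (1 + x ^ 2) ^ (θ / 4) := by
        gcongr
        · norm_num
        · linarith
      _ = _ := by norm_num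
  calc _ ≤ (4 * (1 + x ^ 2) ^ (θ / 4) / (θ / 2)) * (1 + x ^ 2) ^ (-((1 + θ) / 2)) := by
        gcongr
        exact h1.trans (by gcongr)
    _ = 8 / θ * ((1 + x ^ 2) ^ (θ / 4) * (1 + x ^ 2) ^ (-((1 + θ) / 2))) := by
        field_simp; norm_num
    _ = _ := by
        rw [← Real.rpow_add hp]
        congr 2; ring

lemma one_add_sq_rpow_le_of_abs_sub_le {θ : ℝ} (hθ : 0 < θ) (hθ1 : θ ≤ 1) {n : ℤ} {t : ℝ}
    (ht : |t - n| ≤ 1 / 2) :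
    (1 + t ^ 2) ^ (-((1 + θ) / 2)) ≤ 4 * (1 + (n : ℝ) ^ 2) ^ (-((1 + θ) / 2)) := by
  have h1 : (1 + (n : ℝ) ^ 2) / 4 ≤ 1 + t ^ 2 := by
    rw [abs_le] at ht
    nlinarith [sq_nonneg (2 * t - n), sq_nonneg (t - n)]
  calc _ ≤ ((1 + (n : ℝ) ^ 2) / 4) ^ (-((1 + θ) / 2)) :=
        Real.rpow_le_rpow_of_nonpos (by positivity) h1 (by linarith)
    _ = 4 ^ ((1 + θ) / 2) * (1 + (n : ℝ) ^ 2) ^ (-((1 + θ) / 2)) := by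
        rw [Real.div_rpow (by positivity) (by norm_num), Real.rpow_neg (by norm_num : (0:ℝ) ≤ 4)]
        field_simp
    _ ≤ 4 ^ (1 : ℝ) * (1 + (n : ℝ) ^ 2) ^ (-((1 + θ) / 2)) := by
        gcongr
        · norm_num
        · linarith
    _ = _ := by norm_num

lemma integral_le_of_local_le {φ f : ℝ → ℝ} {K B θ : ℝ} (hθ : 0 < θ) (hθ1 : θ ≤ 1)
    (hB : 0 ≤ B) (hK : 0 ≤ K) (hf : Integrable f) (hφ : Continuous φ) (hφ0 : ∀ t, 0 ≤ φ t)
    (hloc : ∀ m : ℝ, ∫ t in (m - 1 / 2)..(m + 1 / 2), φ t ≤ K * log (|m| + 3))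
    (hfφ : ∀ t, f t ≤ B * φ t * (1 + t ^ 2) ^ (-((1 + θ) / 2))) :
    ∫ t, f t ≤ 576 * (B * K) / θ ^ 2 := by
  have hsum := hf.hasSum_intervalIntegral (-(1 / 2))
  obtain ⟨hs, ht⟩ := summable_int_one_add_sq_rpow (ε := θ / 2) (by positivity) (by linarith)
  have hterm : ∀ n : ℤ, ∫ t in (-(1 / 2) + n : ℝ)..(-(1 / 2) + n + 1), f t ≤
      32 * (B * K) / θ * (1 + (n : ℝ) ^ 2) ^ (-((1 + θ / 2) / 2)) := by
    intro n
    calc _ ≤ ∫ t in (-(1 / 2) + n : ℝ)..(-(1 / 2) + n + 1),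
          B * (4 * (1 + (n : ℝ) ^ 2) ^ (-((1 + θ) / 2))) * φ t := by
          refine intervalIntegral.integral_mono_on (by linarith) hf.intervalIntegrable
            ((hφ.const_mul _).intervalIntegrable _ _) fun t ht ↦ ?_
          calc _ ≤ _ := hfφ t
            _ ≤ B * φ t * (4 * (1 + (n : ℝ) ^ 2) ^ (-((1 + θ) / 2))) := by
              have := hφ0 t
              gcongr
              refine one_add_sq_rpow_le_of_abs_sub_le hθ hθ1 (abs_le.2 ?_)
              constructor <;> linarith [ht.1, ht.2]
            _ = _ := by ring
      _ = B * (4 * (1 + (n : ℝ) ^ 2) ^ (-((1 + θ) / 2))) *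
            ∫ t in ((n : ℝ) - 1 / 2)..(n + 1 / 2), φ t := by
          rw [intervalIntegral.integral_const_mul]
          congr 2 <;> ring
      _ ≤ B * (4 * (1 + (n : ℝ) ^ 2) ^ (-((1 + θ) / 2))) * (K * log (|(n : ℝ)| + 3)) := by
          gcongr
          exact hloc n
      _ = 4 * (B * K) * (log (|(n : ℝ)| + 3) * (1 + (n : ℝ) ^ 2) ^ (-((1 + θ) / 2))) := by ring
      _ ≤ 4 * (B * K) * (8 / θ * (1 + (n : ℝ) ^ 2) ^ (-((1 + θ / 2) / 2))) := by
          exact mul_le_mul_of_nonneg_left (log_abs_add_three_mul_le hθ hθ1 n) (by positivity)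
      _ = _ := by ring
  calc _ ≤ ∑' n : ℤ, 32 * (B * K) / θ * (1 + (n : ℝ) ^ 2) ^ (-((1 + θ / 2) / 2)) :=
        hasSum_le hterm hsum (hs.mul_left _).hasSum
    _ = 32 * (B * K) / θ * ∑' n : ℤ, (1 + (n : ℝ) ^ 2) ^ (-((1 + θ / 2) / 2)) := tsum_mul_left
    _ ≤ 32 * (B * K) / θ * (9 / (θ / 2)) := by gcongr
    _ = _ := by field_simp; ring

end LocalSums

section VerticalShift
open MeasureTheory

lemma exists_norm_zetaErr_mul_perronKernel_le (hRH : RiemannHypothesis) {δ a : ℝ} (hδ : 0 < δ)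
    (hδ1 : δ ≤ 1) (ha : 1 ≤ a) : ∃ D : ℝ, ∀ s : ℂ, s.re ∈ Icc (1 / 2 + δ) 2 →
      ‖zetaErr s * perronKernel a s‖ ≤ D * (1 + s.im ^ 2) ^ (-(3 / 4) : ℝ) := by
  obtain ⟨K, hK, hb⟩ := exists_norm_zetaErr_le hRH
  refine ⟨4 * (K / δ) * a ^ (3 : ℝ) / (1 / 2), fun s hs ↦ ?_⟩
  refine (norm_mul_perronKernel_le (t := s.im) (by linarith) (by norm_num : (0:ℝ) < 1 / 2)
    (by norm_num) (by linarith [hs.1]) (by positivity) rfl (hb δ hδ hδ1 s hs.1 hs.2)).trans ?_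
  gcongr
  linarith [hs.2]

lemma differentiableAt_zetaErr_mul_perronKernel (hRH : RiemannHypothesis) {a : ℝ} (ha : 0 < a)
    {s : ℂ} (hs : 1 / 2 < s.re) :
    DifferentiableAt ℂ (fun s ↦ zetaErr s * perronKernel a s) s :=
  (differentiableAt_zetaErr hRH hs).mul (differentiableAt_perronKernel ha (by linarith))

lemma integrable_zetaErr_mul_perronKernel (hRH : RiemannHypothesis) {δ a : ℝ} (hδ : 0 < δ)
    (hδ1 : δ ≤ 1) (ha : 1 ≤ a) :
    Integrable fun t : ℝ ↦ zetaErr ((1 / 2 + δ : ℝ) + t * Complex.I) *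
      perronKernel a ((1 / 2 + δ : ℝ) + t * Complex.I) := by
  obtain ⟨D, hD⟩ := exists_norm_zetaErr_mul_perronKernel_le hRH hδ hδ1 ha
  exact integrable_vertical (Φ := fun s ↦ zetaErr s * perronKernel a s)
    (fun s hs ↦ differentiableAt_zetaErr_mul_perronKernel hRH (by linarith) (by linarith))
    (fun s hs ↦ hD s ⟨hs.ge, by linarith⟩)

lemma psiErrPrimitive_eq_integral (hRH : RiemannHypothesis) {δ a : ℝ} (hδ : 0 < δ)
    (hδ1 : δ ≤ 1) (ha : 1 < a) :
    (psiErrPrimitive a : ℂ) = (1 / (2 * π) : ℝ) •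
      ∫ t : ℝ, zetaErr ((1 / 2 + δ : ℝ) + t * Complex.I) *
        perronKernel a ((1 / 2 + δ : ℝ) + t * Complex.I) := by
  obtain ⟨D, hD⟩ := exists_norm_zetaErr_mul_perronKernel_le hRH hδ hδ1 ha.le
  rw [psiErrPrimitive_eq_integral_two hRH ha]
  congr 1
  exact (integral_vertical_eq (σ₀ := 1 / 2 + δ) (σ₁ := 2) (by linarith)
    (Φ := fun s ↦ zetaErr s * perronKernel a s)
    (fun s hs ↦ differentiableAt_zetaErr_mul_perronKernel hRH (by linarith) (by linarith [hs.1]))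
    hD).symm

lemma exists_norm_integral_conj_zetaErr_mul_le (hRH : RiemannHypothesis) :
    ∃ K : ℝ, 0 < K ∧ ∀ δ a : ℝ, 0 < δ → δ ≤ 1 / 2 → 1 ≤ a →
      ‖∫ t : ℝ, starRingEnd ℂ (zetaErr ((1 / 2 + δ : ℝ) + t * Complex.I)) *
        perronKernel a ((1 / 2 + δ : ℝ) + t * Complex.I)‖ ≤ K * a ^ (1 + δ) / δ := by
  obtain ⟨K, hK, hb⟩ := exists_norm_zetaErr_le hRH
  have hI : 0 ≤ ∫ t : ℝ, (1 + t ^ 2) ^ (-(3 / 4) : ℝ) :=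
    integral_nonneg fun t ↦ by positivity
  refine ⟨8 * K * (∫ t : ℝ, (1 + t ^ 2) ^ (-(3 / 4) : ℝ)) + 1, by positivity,
    fun δ a hδ hδ1 ha ↦ ?_⟩
  have ha0 : 0 < a := by linarith
  set Φ : ℂ → ℂ := fun s ↦ zetaErr s * perronKernel a ((1 + 2 * δ : ℝ) - s) with hΦdef
  have h1 : ∫ t : ℝ, starRingEnd ℂ (zetaErr ((1 / 2 + δ : ℝ) + t * Complex.I)) *
        perronKernel a ((1 / 2 + δ : ℝ) + t * Complex.I) =
      ∫ t : ℝ, Φ ((1 / 2 + δ : ℝ) + t * Complex.I) := by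
    rw [← integral_neg_eq_self]
    refine integral_congr_ae (ae_of_all _ fun t ↦ ?_)
    simp only [hΦdef, ← zetaErr_conj]
    congr 2
    · simp [Complex.conj_ofNat]
    · push_cast; ring
  have h2 : ∫ t : ℝ, Φ ((1 / 2 + δ : ℝ) + t * Complex.I) =
      ∫ t : ℝ, Φ ((1 + δ : ℝ) + t * Complex.I) := by
    refine integral_vertical_eq (D := 4 * (K / δ) * a ^ (2 : ℝ) / δ) (by linarith)
      (fun s hs ↦ ?_) (fun s hs ↦ ?_)
    · refine (differentiableAt_zetaErr hRH (by linarith [hs.1])).mul ?_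
      refine DifferentiableAt.comp s (differentiableAt_perronKernel ha0 ?_)
        ((differentiableAt_const _).sub differentiableAt_id)
      rw [Complex.sub_re, Complex.ofReal_re]
      linarith [hs.2]
    · refine (norm_mul_perronKernel_le (t := s.im) ha0 hδ (by linarith) ?_ (by positivity) ?_
        (hb δ hδ (by linarith) s hs.1 (by linarith [hs.2]))).trans ?_
      · rw [Complex.sub_re, Complex.ofReal_re]; linarith [hs.2]
      · simp
      · gcongr
        rw [Complex.sub_re, Complex.ofReal_re]; linarith [hs.1]
  have h3 : ∀ t : ℝ, ‖Φ ((1 + δ : ℝ) + t * Complex.I)‖ ≤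
      4 * (K / (1 / 2)) * a ^ (1 + δ) / δ * (1 + t ^ 2) ^ (-(3 / 4) : ℝ) := by
    intro t
    have hre : ((1 + δ : ℝ) + t * Complex.I : ℂ).re = 1 + δ := by simp
    have him : ((1 + δ : ℝ) + t * Complex.I : ℂ).im = t := by simp
    have hre' : ((1 + 2 * δ : ℝ) - ((1 + δ : ℝ) + t * Complex.I) : ℂ).re = δ := by
      rw [Complex.sub_re, hre, Complex.ofReal_re]; ring
    have h := hb (1 / 2) (by norm_num) (by norm_num) ((1 + δ : ℝ) + t * Complex.I)
      (by rw [hre]; linarith) (by rw [hre]; linarith)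
    rw [him] at h
    refine (norm_mul_perronKernel_le (t := t) ha0 hδ (by linarith) hre'.ge (by positivity) ?_
        h).trans_eq ?_
    · rw [Complex.sub_im, him]; simp
    · rw [hre', add_comm δ 1]
  rw [h1, h2]
  calc _ ≤ ∫ t : ℝ, 4 * (K / (1 / 2)) * a ^ (1 + δ) / δ * (1 + t ^ 2) ^ (-(3 / 4) : ℝ) :=
        norm_integral_le_of_norm_le (integrable_one_add_sq_rpow.const_mul _) (ae_of_all _ h3)
    _ = 8 * K * (∫ t : ℝ, (1 + t ^ 2) ^ (-(3 / 4) : ℝ)) * (a ^ (1 + δ) / δ) := by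
        rw [integral_const_mul]; ring
    _ ≤ (8 * K * (∫ t : ℝ, (1 + t ^ 2) ^ (-(3 / 4) : ℝ)) + 1) * (a ^ (1 + δ) / δ) := by
        gcongr; linarith
    _ = _ := by ring

lemma norm_perronKernel_sub_le {b₀ b₁ B : ℝ} (hb₀ : 0 < b₀) (hb : b₀ ≤ b₁) (hB : b₁ ≤ B) {s : ℂ}
    (hs : 0 < s.re) :
    ‖perronKernel b₁ s - perronKernel b₀ s‖ ≤ B ^ s.re / ‖s‖ * (b₁ - b₀) := by
  have hs0 : s ≠ 0 := fun h ↦ by simp [h] at hs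
  have hs1 : s ≠ -1 := fun h ↦ by rw [h] at hs; norm_num at hs
  have hs1' : s + 1 ≠ 0 := fun h ↦ hs1 (eq_neg_of_add_eq_zero_left h)
  have hd : ∀ y ∈ Icc b₀ b₁, HasDerivWithinAt (fun y : ℝ ↦ perronKernel y s) ((y : ℂ) ^ s / s)
      (Icc b₀ b₁) y := by
    intro y hy
    have := (hasDerivAt_ofReal_cpow_const' (x := y) (by linarith [hy.1]) hs1).div_const s
    refine (this.congr_of_eventuallyEq (Eventually.of_forall fun x ↦ ?_)).hasDerivWithinAt
    simp only [perronKernel]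
    field_simp
  have hbd : ∀ y ∈ Icc b₀ b₁, ‖(y : ℂ) ^ s / s‖ ≤ B ^ s.re / ‖s‖ := by
    intro y hy
    rw [norm_div, Complex.norm_cpow_eq_rpow_re_of_pos (by linarith [hy.1])]
    gcongr
    · linarith [hy.1]
    · linarith [hy.2]
  have := (convex_Icc b₀ b₁).norm_image_sub_le_of_norm_hasDerivWithin_le hd hbd
    (left_mem_Icc.2 hb) (right_mem_Icc.2 hb)
  rwa [Real.norm_of_nonneg (by linarith)] at this

lemma le_mul_rpow_of_le_div {x p X Y θ : ℝ} (hx : 0 ≤ x) (hp : 0 < p) (hX : 1 ≤ X) (hY : 0 < Y)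
    (hθ : 0 < θ) (hθ1 : θ ≤ 1) (h1 : x ≤ p / X) (h2 : x ≤ p * Y / X ^ 2) (hYθ : Y ^ θ ≤ 2) :
    x ≤ 2 * p * X ^ (-(1 + θ)) := by
  have hX0 : 0 < X := by linarith
  rcases hx.eq_or_lt with rfl | hx
  · positivity
  calc x = x ^ (1 - θ) * x ^ θ := by rw [← Real.rpow_add hx]; simp
    _ ≤ (p / X) ^ (1 - θ) * (p * Y / X ^ 2) ^ θ := by
        gcongr
    _ = (p / X) ^ (1 - θ) * ((p / X) ^ θ * (Y ^ θ / X ^ θ)) := by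
        rw [← Real.div_rpow hY.le hX0.le, ← Real.mul_rpow (by positivity) (by positivity)]
        congr 2
        field_simp
    _ = p / X * (Y ^ θ / X ^ θ) := by
        rw [← mul_assoc, ← Real.rpow_add (by positivity)]; simp
    _ ≤ p / X * (2 / X ^ θ) := by gcongr
    _ = _ := by
        rw [Real.rpow_neg hX0.le, Real.rpow_add hX0, Real.rpow_one]
        field_simp

end VerticalShift

section PrimitiveDifference
open MeasureTheory

lemma rpow_one_div_log {a : ℝ} (ha : 1 < a) : a ^ (1 / log a) = exp 1 := by
  rw [Real.rpow_def_of_pos (by linarith), mul_one_div_cancel (Real.log_pos ha).ne']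

lemma sqrt_rpow_one_div_log_le {a : ℝ} (ha : 1 < a) : √a ^ (1 / log a) ≤ 2 := by
  have h : √a ^ (1 / log a) = √(exp 1) := by
    rw [Real.sqrt_eq_rpow, Real.sqrt_eq_rpow, ← Real.rpow_mul (by linarith), mul_comm,
      Real.rpow_mul (by linarith), rpow_one_div_log ha]
  rw [h, Real.sqrt_le_left (by norm_num)]
  linarith [Real.exp_one_lt_d9]

lemma two_mul_rpow_le {a : ℝ} (ha : exp 2 ≤ a) :
    (2 * a) ^ (1 / 2 + 1 / log a) ≤ 6 * √a := by
  have h1 : 1 < a := (Real.one_lt_exp_iff.2 two_pos).trans_le ha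
  have hl : 2 ≤ log a := (Real.le_log_iff_exp_le (by linarith)).2 ha
  have h2 : 1 / log a ≤ 1 / 2 := one_div_le_one_div_of_le two_pos hl
  have h3 : (2 : ℝ) ^ (1 / 2 + 1 / log a) ≤ 2 := by
    calc (2 : ℝ) ^ (1 / 2 + 1 / log a) ≤ 2 ^ (1 : ℝ) := by
          gcongr
          · norm_num
          · linarith
      _ = 2 := by norm_num
  rw [Real.mul_rpow two_pos.le (by linarith), Real.rpow_add (by linarith : 0 < a),
    rpow_one_div_log h1, ← Real.sqrt_eq_rpow]
  calc _ ≤ 2 * (√a * 3) := by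
        gcongr
        linarith [Real.exp_one_lt_d9]
    _ = _ := by ring

lemma norm_perronKernel_sub_le_rpow {a b₀ b₁ : ℝ} (ha : exp 2 ≤ a) (hb₀ : 0 < b₀)
    (hb : b₀ ≤ b₁) (hb₁ : b₁ ≤ 2 * a) (hbb : b₁ - b₀ ≤ √a) (t : ℝ) :
    ‖perronKernel b₁ ((1 / 2 + 1 / log a : ℝ) + t * Complex.I) -
      perronKernel b₀ ((1 / 2 + 1 / log a : ℝ) + t * Complex.I)‖ ≤
      96 * a * (1 + t ^ 2) ^ (-((1 + 1 / log a) / 2)) := by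
  have h1 : 1 < a := (Real.one_lt_exp_iff.2 two_pos).trans_le ha
  have hl : 2 ≤ log a := (Real.le_log_iff_exp_le (by linarith)).2 ha
  have hθ : 0 < 1 / log a := by positivity
  have h2 : 1 / log a ≤ 1 / 2 := one_div_le_one_div_of_le two_pos hl
  have hM := two_mul_rpow_le ha
  set θ := 1 / log a with hθdef
  set s : ℂ := (1 / 2 + θ : ℝ) + t * Complex.I with hsdef
  have hre : s.re = 1 / 2 + θ := by simp [hsdef]
  have him : s.im = t := by simp [hsdef]
  set X := √(1 + t ^ 2) with hX
  have hX1 : 1 ≤ X := Real.one_le_sqrt.2 (by nlinarith [sq_nonneg t])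
  have hX2 : X ^ 2 = 1 + t ^ 2 := Real.sq_sqrt (by positivity)
  have haa : √a * √a = a := Real.mul_self_sqrt (by linarith)
  have hsX : X / 2 ≤ ‖s‖ := by
    refine abs_le_of_sq_le_sq' ?_ (norm_nonneg _) |>.2
    rw [div_pow, hX2, Complex.sq_norm, Complex.normSq_apply, hre, him]
    nlinarith [sq_nonneg t]
  have hk1 := norm_perronKernel_sub_le hb₀ hb hb₁ (s := s) (by rw [hre]; linarith)
  have hk : ∀ b, 0 < b → b ≤ 2 * a → ‖perronKernel b s‖ ≤ 24 * (a * √a) / X ^ 2 := by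
    intro b hb0 hb2
    have h := norm_perronKernel_le (η := 1 / 2) (w := s) hb0 (by norm_num) (by norm_num)
      (by rw [hre]; linarith)
    calc _ ≤ _ := h
      _ = b ^ (1 / 2 + θ + 1) / (1 / 2 * X ^ 2) := by rw [hre, him, hX2]
      _ ≤ (2 * a) ^ (1 / 2 + θ + 1) / (1 / 2 * X ^ 2) := by gcongr
      _ = (2 * a) ^ (1 / 2 + θ) * (2 * a) / (1 / 2 * X ^ 2) := by
          rw [Real.rpow_add (by positivity), Real.rpow_one]
      _ ≤ 6 * √a * (2 * a) / (1 / 2 * X ^ 2) := by gcongr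
      _ = _ := by field_simp; ring
  have hfin := le_mul_rpow_of_le_div (x := ‖perronKernel b₁ s - perronKernel b₀ s‖)
    (p := 48 * a) (X := X) (Y := √a) (θ := θ) (norm_nonneg _) (by positivity) hX1 (by positivity)
    hθ (by linarith) ?_ ?_ (sqrt_rpow_one_div_log_le h1)
  · refine hfin.trans_eq ?_
    rw [hX, Real.sqrt_eq_rpow, ← Real.rpow_mul (by positivity)]
    ring_nf
  · calc _ ≤ _ := hk1
      _ ≤ 6 * √a / (X / 2) * √a := by
          rw [hre]
          gcongr
      _ = 12 * (√a * √a) / X := by field_simp; ring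
      _ ≤ 48 * a / X := by rw [haa]; gcongr; norm_num
  · calc _ ≤ ‖perronKernel b₁ s‖ + ‖perronKernel b₀ s‖ := norm_sub_le _ _
      _ ≤ 24 * (a * √a) / X ^ 2 + 24 * (a * √a) / X ^ 2 := by
          gcongr
          · exact hk _ (by linarith) hb₁
          · exact hk _ hb₀ (by linarith)
      _ = _ := by ring

lemma exists_abs_psiErrPrimitive_sub_le (hRH : RiemannHypothesis) :
    ∃ C : ℝ, 0 < C ∧ ∀ a b₀ b₁ : ℝ, exp 2 ≤ a → 1 < b₀ → b₀ ≤ b₁ → b₁ ≤ 2 * a →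
      b₁ - b₀ ≤ √a → |psiErrPrimitive b₁ - psiErrPrimitive b₀| ≤ C * a * log a ^ 2 := by
  obtain ⟨K, hK, hloc⟩ := exists_integral_abs_re_logDeriv_riemannZeta₁_le hRH
  obtain ⟨J, hJ, hconj⟩ := exists_norm_integral_conj_zetaErr_mul_le hRH
  refine ⟨576 * (96 * (K + 1)) + 12 * J, by positivity, fun a b₀ b₁ ha hb₀ hb hb₁ hbb ↦ ?_⟩
  have h1 : 1 < a := (Real.one_lt_exp_iff.2 two_pos).trans_le ha
  have hl : 2 ≤ log a := (Real.le_log_iff_exp_le (by linarith)).2 ha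
  have hδ : 0 < 1 / log a := by positivity
  have hδ2 : 1 / log a ≤ 1 / 2 := one_div_le_one_div_of_le two_pos hl
  have hker := norm_perronKernel_sub_le_rpow ha (by linarith) hb hb₁ hbb
  have hM := two_mul_rpow_le ha
  have hlδ : 1 / (1 / log a) = log a := one_div_one_div _
  set δ := 1 / log a with hδdef
  set s : ℝ → ℂ := fun t ↦ (1 / 2 + δ : ℝ) + t * Complex.I with hs
  set Z : ℝ → ℂ := fun t ↦ zetaErr (s t) with hZ
  set k : ℝ → ℂ := fun t ↦ perronKernel b₁ (s t) - perronKernel b₀ (s t) with hk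
  have hsre : ∀ t, (s t).re = 1 / 2 + δ := fun t ↦ by simp [hs]
  have hscont : Continuous s := by fun_prop
  have hZc : Continuous Z := continuous_iff_continuousAt.2 fun t ↦
    (differentiableAt_zetaErr hRH (by rw [hsre]; linarith)).continuousAt.comp hscont.continuousAt
  have hi : ∀ b, 1 ≤ b → Integrable fun t ↦ Z t * perronKernel b (s t) := fun b hb ↦
    integrable_zetaErr_mul_perronKernel hRH hδ (by linarith) hb
  have hic : ∀ b, 1 ≤ b → Integrable fun t ↦ starRingEnd ℂ (Z t) * perronKernel b (s t) := by
    intro b hb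
    have hpc : Continuous fun t ↦ perronKernel b (s t) := continuous_iff_continuousAt.2 fun t ↦
      (differentiableAt_perronKernel (by linarith)
        (by rw [hsre]; linarith)).continuousAt.comp hscont.continuousAt
    refine (hi b hb).mono ?_ (ae_of_all _ fun t ↦ by simp)
    exact ((Complex.continuous_conj.comp hZc).mul hpc).aestronglyMeasurable
  have hb₁1 : 1 < b₁ := by linarith
  have hik : Integrable fun t ↦ Z t * k t := by
    simp only [hk, mul_sub]; exact (hi b₁ hb₁1.le).sub (hi b₀ hb₀.le)
  have hikc : Integrable fun t ↦ starRingEnd ℂ (Z t) * k t := by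
    simp only [hk, mul_sub]; exact (hic b₁ hb₁1.le).sub (hic b₀ hb₀.le)
  have hR : ((psiErrPrimitive b₁ - psiErrPrimitive b₀ : ℝ) : ℂ) =
      (1 / (2 * π) : ℝ) • ∫ t, Z t * k t := by
    rw [Complex.ofReal_sub, psiErrPrimitive_eq_integral hRH hδ (by linarith) hb₁1,
      psiErrPrimitive_eq_integral hRH hδ (by linarith) hb₀, ← smul_sub,
      ← integral_sub (hi b₁ hb₁1.le) (hi b₀ hb₀.le)]
    simp only [hk, mul_sub, hZ, hs]
  have hJb : ∀ b, 1 ≤ b → b ≤ 2 * a →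
      ‖∫ t, starRingEnd ℂ (Z t) * perronKernel b (s t)‖ ≤ 12 * J * a * log a := by
    intro b hb hb2
    refine (hconj δ b hδ hδ2 hb).trans ?_
    have : b ^ (1 + δ) ≤ 12 * a := by
      calc _ ≤ (2 * a) ^ (1 + δ) := by gcongr
        _ = (2 * a) ^ (1 / 2 + δ) * √(2 * a) := by
          rw [Real.sqrt_eq_rpow, ← Real.rpow_add (by positivity)]; ring_nf
        _ ≤ 6 * √a * (2 * √a) := by
          gcongr
          rw [Real.sqrt_mul two_pos.le]
          gcongr
          rw [Real.sqrt_le_left (by norm_num)]; norm_num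
        _ = 12 * (√a * √a) := by ring
        _ = 12 * a := by rw [Real.mul_self_sqrt (by linarith)]
    calc _ ≤ J * (12 * a) / δ := by gcongr
      _ = 12 * J * a * (1 / δ) := by ring
      _ = _ := by rw [hlδ]
  have hcj : ‖∫ t, starRingEnd ℂ (Z t) * k t‖ ≤ 24 * J * a * log a := by
    have : ∫ t, starRingEnd ℂ (Z t) * k t = (∫ t, starRingEnd ℂ (Z t) * perronKernel b₁ (s t)) -
        ∫ t, starRingEnd ℂ (Z t) * perronKernel b₀ (s t) := by
      rw [← integral_sub (hic b₁ hb₁1.le) (hic b₀ hb₀.le)]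
      simp only [hk, mul_sub]
    rw [this]
    have h1 := hJb b₁ hb₁1.le hb₁
    have h2 := hJb b₀ hb₀.le (by linarith)
    refine (norm_sub_le _ _).trans ?_
    linarith
  have hRe : ∫ t, |(Z t).re| * ‖k t‖ ≤ 576 * (96 * a * (K + 1)) / δ ^ 2 := by
    have hre : ∀ t, Z t + starRingEnd ℂ (Z t) = ((2 * (Z t).re : ℝ) : ℂ) := fun t ↦
      Complex.add_conj _
    refine integral_le_of_local_le (φ := fun t ↦ |(Z t).re|) hδ (by linarith) (by positivity)
      (by positivity) ?_ (Complex.continuous_re.comp hZc).abs (fun t ↦ abs_nonneg _) ?_ ?_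
    · have := ((hik.add hikc).norm).const_mul (1 / 2)
      refine this.congr (ae_of_all _ fun t ↦ ?_)
      simp only [Pi.add_apply, ← add_mul, hre, norm_mul, Complex.norm_real, Real.norm_eq_abs,
        abs_two]
      ring
    · intro m
      have hle : ∀ t, |(Z t).re| ≤ |(logDeriv riemannZeta₁ (s t)).re| + 1 := fun t ↦ by
        simp only [hZ, zetaErr, Complex.sub_re, Complex.neg_re, Complex.one_re]
        refine (abs_sub _ _).trans ?_
        simp
      have hLc : Continuous fun t ↦ |(logDeriv riemannZeta₁ (s t)).re| := by
        have : ∀ t, logDeriv riemannZeta₁ (s t) = -(Z t + 1) := fun t ↦ by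
          simp only [hZ, zetaErr]; ring
        simp only [this]
        fun_prop
      have hlog : 1 ≤ log (|m| + 3) := by
        rw [Real.le_log_iff_exp_le (by positivity)]
        linarith [Real.exp_one_lt_d9, abs_nonneg m]
      calc _ ≤ ∫ t in (m - 1 / 2)..(m + 1 / 2), (|(logDeriv riemannZeta₁ (s t)).re| + 1) :=
            intervalIntegral.integral_mono_on (by linarith)
              ((Complex.continuous_re.comp hZc).abs.intervalIntegrable _ _)
              ((hLc.add continuous_const).intervalIntegrable _ _) fun t _ ↦ hle t
        _ = (∫ t in (m - 1 / 2)..(m + 1 / 2), |(logDeriv riemannZeta₁ (s t)).re|) + 1 := by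
            rw [intervalIntegral.integral_add (hLc.intervalIntegrable _ _)
              (continuous_const.intervalIntegrable _ _)]
            simp
            ring
        _ ≤ K * log (|m| + 3) + 1 * log (|m| + 3) := by
            gcongr
            · exact hloc δ hδ (by linarith) m
            · linarith
        _ = _ := by ring
    · intro t
      calc _ ≤ |(Z t).re| * (96 * a * (1 + t ^ 2) ^ (-((1 + δ) / 2))) := by
            gcongr
            exact hker t
        _ = _ := by ring
  have hsum : ‖∫ t, Z t * k t‖ ≤ 2 * (576 * (96 * a * (K + 1)) / δ ^ 2) + 24 * J * a * log a := by
    have e : ∫ t, Z t * k t = (∫ t, (Z t * k t + starRingEnd ℂ (Z t) * k t)) -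
        ∫ t, starRingEnd ℂ (Z t) * k t := by
      rw [integral_add hik hikc]; ring
    rw [e]
    refine (norm_sub_le _ _).trans (add_le_add ?_ hcj)
    calc _ ≤ ∫ t, ‖Z t * k t + starRingEnd ℂ (Z t) * k t‖ := norm_integral_le_integral_norm _
      _ = ∫ t, 2 * (|(Z t).re| * ‖k t‖) := by
          refine integral_congr_ae (ae_of_all _ fun t ↦ ?_)
          simp only [← add_mul, Complex.add_conj, norm_mul, Complex.norm_real, Real.norm_eq_abs,
            abs_two]
          ring
      _ = 2 * ∫ t, |(Z t).re| * ‖k t‖ := integral_const_mul _ _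
      _ ≤ _ := by gcongr
  have hnorm : |psiErrPrimitive b₁ - psiErrPrimitive b₀| = 1 / (2 * π) * ‖∫ t, Z t * k t‖ := by
    rw [← Real.norm_eq_abs, ← Complex.norm_real, hR, norm_smul, Real.norm_of_nonneg (by positivity)]
  have hπ : 1 / (2 * π) ≤ 1 / 2 := by
    refine one_div_le_one_div_of_le two_pos ?_
    linarith [Real.pi_gt_three]
  rw [hnorm]
  calc _ ≤ 1 / 2 * (2 * (576 * (96 * a * (K + 1)) / δ ^ 2) + 24 * J * a * log a) := by gcongr
    _ = 576 * (96 * (K + 1)) * a * (1 / δ) ^ 2 + 12 * J * a * log a := by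
        field_simp; ring
    _ = 576 * (96 * (K + 1)) * a * log a ^ 2 + 12 * J * a * log a := by rw [hlδ]
    _ ≤ 576 * (96 * (K + 1)) * a * log a ^ 2 + 12 * J * a * log a ^ 2 := by
        gcongr
        nlinarith
    _ = _ := by ring

end PrimitiveDifference

section ThetaBound
open MeasureTheory

lemma exists_abs_psi_sub_self_le_of_exp_two_le (hRH : RiemannHypothesis) :
    ∃ C : ℝ, 0 < C ∧ ∀ a : ℝ, exp 2 ≤ a →
      |Chebyshev.psi a - a| ≤ C * √a * log a ^ 2 := by
  obtain ⟨C, hC, h⟩ := exists_abs_psiErrPrimitive_sub_le hRH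
  refine ⟨C + 1, by positivity, fun a ha ↦ ?_⟩
  have he : 4 ≤ exp 2 := by
    have : exp 2 = exp 1 * exp 1 := by rw [← Real.exp_add]; norm_num
    nlinarith [Real.exp_one_gt_d9]
  have h1 : 1 < a := by linarith
  have hl : 2 ≤ log a := (Real.le_log_iff_exp_le (by linarith)).2 ha
  have hs2 : 2 ≤ √a := Real.le_sqrt_of_sq_le (by linarith)
  have hss : √a * √a = a := Real.mul_self_sqrt (by linarith)
  have hs0 : 0 < √a := by linarith
  have hsa : √a + 2 ≤ a := by nlinarith
  have hdiff : ∀ x y, psiErrPrimitive y - psiErrPrimitive x = ∫ u in x..y, (Chebyshev.psi u - u) :=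
    fun x y ↦ intervalIntegral.integral_interval_sub_left
      (intervalIntegrable_psi_sub_self _ _) (intervalIntegrable_psi_sub_self _ _)
  have hup : (Chebyshev.psi a - a - √a) * √a ≤ C * a * log a ^ 2 := by
    calc _ = ∫ u in a..(a + √a), (Chebyshev.psi a - a - √a) := by
          rw [intervalIntegral.integral_const, smul_eq_mul]; ring
      _ ≤ ∫ u in a..(a + √a), (Chebyshev.psi u - u) :=
          intervalIntegral.integral_mono_on (by linarith) (by simp)
            (intervalIntegrable_psi_sub_self _ _) fun u hu ↦ by
              linarith [Chebyshev.psi_mono hu.1, hu.2]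
      _ ≤ _ := by
          rw [← hdiff]
          exact (le_abs_self _).trans
            (h a a (a + √a) ha h1 (by linarith) (by linarith) (by linarith))
  have hlow : (a - Chebyshev.psi a - √a) * √a ≤ C * a * log a ^ 2 := by
    calc _ = -∫ u in (a - √a)..a, (Chebyshev.psi a - a + √a) := by
          rw [intervalIntegral.integral_const, smul_eq_mul]; ring
      _ ≤ -∫ u in (a - √a)..a, (Chebyshev.psi u - u) := by
          refine neg_le_neg (intervalIntegral.integral_mono_on (by linarith)
            (intervalIntegrable_psi_sub_self _ _) (by simp) fun u hu ↦ ?_)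
          linarith [Chebyshev.psi_mono hu.2, hu.1]
      _ ≤ _ := by
          rw [← hdiff]
          exact (neg_le_abs _).trans
            (h a (a - √a) a ha (by linarith) (by linarith) (by linarith) (by linarith))
  have hcancel : ∀ z : ℝ, (z - √a) * √a ≤ C * a * log a ^ 2 → z ≤ (C + 1) * √a * log a ^ 2 := by
    intro z hz
    have : z - √a ≤ C * √a * log a ^ 2 := by
      refine le_of_mul_le_mul_right (hz.trans_eq ?_) hs0
      linear_combination (-(C * log a ^ 2)) * hss
    have h2 : √a * 1 ≤ √a * log a ^ 2 := by
      gcongr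
      nlinarith
    linarith
  rw [abs_le]
  constructor
  · linarith [hcancel _ hlow]
  · exact hcancel _ hup

lemma exists_abs_theta_sub_self_le (hRH : RiemannHypothesis) :
    ∃ C : ℝ, 0 < C ∧ ∀ a : ℝ, 2 ≤ a →
      |Chebyshev.theta a - a| ≤ C * √a * log a ^ 2 := by
  obtain ⟨C, hC, h⟩ := exists_abs_psi_sub_self_le_of_exp_two_le hRH
  have hl2 := Real.log_two_gt_d9
  refine ⟨C + 60, by positivity, fun a ha ↦ ?_⟩
  have hla : 0.69 ≤ log a := by
    linarith [Real.log_le_log two_pos ha]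
  have hs1 : 1 ≤ √a := Real.one_le_sqrt.2 (by linarith)
  rcases le_total (exp 2) a with h2 | h2
  · have h3 := Chebyshev.psi_sub_theta_le (x := a) (by linarith)
    have h4 := Chebyshev.theta_le_psi a
    have h5 := h a h2
    have h6 : 2 * √a * log a ≤ 60 * √a * log a ^ 2 := by
      rw [pow_two]
      have : 0 ≤ √a * log a := by positivity
      nlinarith
    rw [abs_le] at h5 ⊢
    constructor <;> linarith
  · have he : exp 2 ≤ 8 := by
      have : exp 2 = exp 1 * exp 1 := by rw [← Real.exp_add]; norm_num
      nlinarith [Real.exp_one_lt_d9, Real.exp_pos 1]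
    have h3 := Chebyshev.theta_le_log4_mul_x (x := a) (by linarith)
    have h4 := Chebyshev.theta_nonneg a
    have h5 : log 4 ≤ 2 := by
      rw [Real.log_le_iff_le_exp (by norm_num)]
      have : exp 2 = exp 1 * exp 1 := by rw [← Real.exp_add]; norm_num
      nlinarith [Real.exp_one_gt_d9]
    have h6 : 1 * (0.69 : ℝ) ^ 2 ≤ √a * log a ^ 2 := by gcongr
    have h7 : 0 ≤ C * (√a * log a ^ 2) := by positivity
    have h8 : log 4 * a ≤ 16 := by nlinarith
    rw [abs_le]
    constructor <;> nlinarith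

end ThetaBound

section MertensSum
open MeasureTheory

noncomputable def mertensWeight (t : ℝ) : ℝ := (log t + 1) / (t * log t) ^ 2

lemma hasDerivAt_inv_mul_log {t : ℝ} (ht : 1 < t) :
    HasDerivAt (fun y : ℝ ↦ (y * log y)⁻¹) (-mertensWeight t) t := by
  have hl := Real.log_pos ht
  have h0 : 0 < t := by linarith
  refine ((Real.hasDerivAt_mul_log h0.ne').inv (by positivity)).congr_deriv ?_
  rw [mertensWeight]; ring

lemma continuousOn_mertensWeight : ContinuousOn mertensWeight (Ioi 1) := by
  intro t ht
  have ht : 1 < t := ht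
  have hl := Real.log_pos ht
  have h0 : 0 < t := by linarith
  refine ContinuousAt.continuousWithinAt ?_
  unfold mertensWeight
  fun_prop (disch := positivity)

lemma intervalIntegrable_mertensWeight_mul {x : ℝ} (hx : 2 ≤ x) {f : ℝ → ℝ}
    (hf : IntervalIntegrable f volume 2 x) :
    IntervalIntegrable (fun t ↦ mertensWeight t * f t) volume 2 x := by
  refine hf.continuousOn_mul (continuousOn_mertensWeight.mono fun t ht ↦ ?_)
  rw [uIcc_of_le hx] at ht
  exact lt_of_lt_of_le one_lt_two ht.1

lemma sum_one_div_prime_eq {x : ℝ} (hx : 2 ≤ x) :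
    ∑ p ∈ (Finset.Iic ⌊x⌋₊).filter Nat.Prime, 1 / (p : ℝ) =
      Chebyshev.theta x / (x * log x) +
        ∫ t in (2 : ℝ)..x, mertensWeight t * Chebyshev.theta t := by
  set c : ℕ → ℝ := fun k ↦ if k.Prime then log k else 0 with hc
  have hθ : ∀ t, ∑ k ∈ Finset.Icc 0 ⌊t⌋₊, c k = Chebyshev.theta t := fun t ↦ by
    rw [Chebyshev.theta_eq_sum_Icc, Finset.sum_filter]
  have hd : ∀ t ∈ Icc 2 x, deriv (fun y : ℝ ↦ (y * log y)⁻¹) t = -mertensWeight t :=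
    fun t ht ↦ (hasDerivAt_inv_mul_log (by linarith [ht.1])).deriv
  have h := sum_mul_eq_sub_integral_mul₁ (c := c) (f := fun y : ℝ ↦ (y * log y)⁻¹)
    (by simp [hc]) (by simp [hc]) x
    (fun t ht ↦ (hasDerivAt_inv_mul_log (by linarith [ht.1])).differentiableAt) (by
      refine IntegrableOn.congr_fun ?_ (fun t ht ↦ (hd t ht).symm) measurableSet_Icc
      exact (continuousOn_mertensWeight.mono fun t ht ↦
        lt_of_lt_of_le one_lt_two ht.1).neg.integrableOn_Icc)
  simp only [hθ] at h
  rw [Finset.sum_filter, show Finset.Iic ⌊x⌋₊ = Finset.Icc 0 ⌊x⌋₊ from rfl]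
  have h2 : ∑ k ∈ Finset.Icc 0 ⌊x⌋₊, (if k.Prime then 1 / (k : ℝ) else 0) =
      ∑ k ∈ Finset.Icc 0 ⌊x⌋₊, ((k : ℝ) * log k)⁻¹ * c k := by
    refine Finset.sum_congr rfl fun k _ ↦ ?_
    simp only [hc]
    split_ifs with hk
    · have h2 : (1 : ℝ) < k := by exact_mod_cast hk.one_lt
      have := Real.log_pos h2
      field_simp
    · simp
  rw [h2, h, intervalIntegral.integral_of_le hx, sub_eq_add_neg, ← integral_neg,
    div_eq_inv_mul]
  congr 1
  refine setIntegral_congr_fun measurableSet_Ioc fun t ht ↦ ?_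
  simp only [hd t ⟨ht.1.le, ht.2⟩]
  ring

lemma log_log_eq {x : ℝ} (hx : 2 ≤ x) :
    log (log x) = log (log 2) - 1 / log 2 + x / (x * log x) +
      ∫ t in (2 : ℝ)..x, mertensWeight t * t := by
  have h := intervalIntegral.integral_eq_sub_of_hasDerivAt (a := 2) (b := x)
    (f := fun t ↦ log (log t) - (log t)⁻¹) (f' := fun t ↦ mertensWeight t * t)
    (fun t ht ↦ by
      rw [uIcc_of_le hx] at ht
      have h1 : 1 < t := by linarith [ht.1]
      have hl := Real.log_pos h1
      have h0 : 0 < t := by linarith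
      refine (((Real.hasDerivAt_log h0.ne').log hl.ne').sub
        ((Real.hasDerivAt_log h0.ne').inv hl.ne')).congr_deriv ?_
      rw [mertensWeight]
      field_simp
      ring) (intervalIntegrable_mertensWeight_mul hx (continuous_id.intervalIntegrable _ _))
  rw [h]
  have h0 : 0 < x := by linarith
  have := Real.log_pos (by linarith : 1 < x)
  field_simp
  ring

lemma hasDerivAt_neg_log_div_sqrt {t : ℝ} (ht : 0 < t) :
    HasDerivAt (fun y ↦ -((2 * log y + 4) / √y)) (log t / (t * √t)) t := by
  have hs : 0 < √t := Real.sqrt_pos.2 ht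
  have hss : √t ^ 2 = t := Real.sq_sqrt ht.le
  refine ((((Real.hasDerivAt_log ht.ne').const_mul 2).add_const 4).div
    (Real.hasDerivAt_sqrt ht.ne') hs.ne').neg.congr_deriv ?_
  rw [hss]
  field_simp
  linear_combination (-4 : ℝ) * hss

lemma tendsto_neg_log_div_sqrt :
    Tendsto (fun y : ℝ ↦ -((2 * log y + 4) / √y)) atTop (nhds 0) := by
  have h1 : Tendsto (fun y : ℝ ↦ log y / √y) atTop (nhds 0) := by
    have := (isLittleO_log_rpow_atTop (r := 1 / 2) (by norm_num)).tendsto_div_nhds_zero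
    simpa only [Real.sqrt_eq_rpow] using this
  have h2 : Tendsto (fun y : ℝ ↦ (√y)⁻¹) atTop (nhds 0) :=
    tendsto_inv_atTop_zero.comp Real.tendsto_sqrt_atTop
  have := ((h1.const_mul 2).add (h2.const_mul 4)).neg
  simp only [mul_zero, add_zero, neg_zero] at this
  exact this.congr fun y ↦ by ring

lemma integrableOn_log_div_mul_sqrt {x : ℝ} (hx : 1 ≤ x) :
    IntegrableOn (fun t ↦ log t / (t * √t)) (Ioi x) :=
  integrableOn_Ioi_deriv_of_nonneg' (fun t ht ↦ hasDerivAt_neg_log_div_sqrt (by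
    linarith [mem_Ici.1 ht])) (fun t ht ↦ by
      have : 1 < t := hx.trans_lt ht
      have := Real.log_pos this
      positivity) tendsto_neg_log_div_sqrt

lemma integral_log_div_mul_sqrt {x : ℝ} (hx : 1 ≤ x) :
    ∫ t in Ioi x, log t / (t * √t) = (2 * log x + 4) / √x := by
  rw [integral_Ioi_of_hasDerivAt_of_nonneg' (fun t ht ↦ hasDerivAt_neg_log_div_sqrt (by
    linarith [mem_Ici.1 ht])) (fun t ht ↦ by
      have : 1 < t := hx.trans_lt ht
      have := Real.log_pos this
      positivity) tendsto_neg_log_div_sqrt]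
  ring

lemma exists_abs_sum_one_div_prime_sub_le (hRH : RiemannHypothesis) :
    ∃ c C : ℝ, 0 < C ∧ ∀ x : ℝ, 2 ≤ x →
      |∑ p ∈ (Finset.Iic ⌊x⌋₊).filter Nat.Prime, 1 / (p : ℝ) - log (log x) - c| ≤
        C * log x / √x := by
  obtain ⟨C, hC, h⟩ := exists_abs_theta_sub_self_le hRH
  set E : ℝ → ℝ := fun t ↦ Chebyshev.theta t - t with hE
  have hl2 := Real.log_two_gt_d9
  have hbd : ∀ t, 2 ≤ t → |mertensWeight t * E t| ≤ 3 * C * (log t / (t * √t)) := by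
    intro t ht
    have h0 : 0 < t := by linarith
    have hs : 0 < √t := Real.sqrt_pos.2 h0
    have hl : 0.69 ≤ log t := by linarith [Real.log_le_log two_pos ht]
    have hl0 : 0 < log t := by linarith
    have hw : 0 ≤ mertensWeight t := by unfold mertensWeight; positivity
    rw [abs_mul, abs_of_nonneg hw]
    calc _ ≤ (3 * log t) / (t * log t) ^ 2 * (C * √t * log t ^ 2) := by
          unfold mertensWeight
          gcongr
          · linarith
          · exact h t ht
      _ = 3 * C * (log t * √t / t ^ 2) := by field_simp
      _ = _ := by
          congr 1
          field_simp
          rw [Real.sq_sqrt h0.le]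
  have hm : Measurable E := Chebyshev.theta_mono.measurable.sub measurable_id
  have hint : IntegrableOn (fun t ↦ mertensWeight t * E t) (Ioi 2) := by
    refine ((integrableOn_log_div_mul_sqrt one_le_two).const_mul (3 * C)).mono' ?_ ?_
    · refine ContinuousOn.aestronglyMeasurable ?_ measurableSet_Ioi |>.mul
        hm.aestronglyMeasurable
      exact continuousOn_mertensWeight.mono (Ioi_subset_Ioi one_le_two)
    · exact (ae_restrict_mem measurableSet_Ioi).mono fun t ht ↦ hbd t (mem_Ioi.1 ht).le
  set I := ∫ t in Ioi 2, mertensWeight t * E t with hI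
  refine ⟨1 / log 2 - log (log 2) + I, C + 3 * C * 8, by positivity, fun x hx ↦ ?_⟩
  have h0 : 0 < x := by linarith
  have hs : 0 < √x := Real.sqrt_pos.2 h0
  have hl : 0.69 ≤ log x := by linarith [Real.log_le_log two_pos hx]
  have hl0 : 0 < log x := by linarith
  have hθi : IntervalIntegrable Chebyshev.theta volume 2 x :=
    Chebyshev.theta_mono.intervalIntegrable
  have hsplit : ∫ t in (2 : ℝ)..x, mertensWeight t * Chebyshev.theta t =
      (∫ t in (2 : ℝ)..x, mertensWeight t * t) + ∫ t in (2 : ℝ)..x, mertensWeight t * E t := by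
    have hid : IntervalIntegrable (fun t : ℝ ↦ t) volume 2 x :=
      continuous_id.intervalIntegrable _ _
    rw [← intervalIntegral.integral_add (intervalIntegrable_mertensWeight_mul hx hid)
      (intervalIntegrable_mertensWeight_mul hx (hθi.sub hid))]
    refine intervalIntegral.integral_congr fun t _ ↦ ?_
    ring
  have htail : ∫ t in (2 : ℝ)..x, mertensWeight t * E t =
      I - ∫ t in Ioi x, mertensWeight t * E t := by
    rw [hI, ← intervalIntegral.integral_interval_add_Ioi hint (hint.mono_set (Ioi_subset_Ioi hx))]
    ring
  have htb : |∫ t in Ioi x, mertensWeight t * E t| ≤ 3 * C * (8 * (log x / √x)) := by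
    calc _ ≤ ∫ t in Ioi x, 3 * C * (log t / (t * √t)) := by
          rw [← Real.norm_eq_abs]
          refine norm_integral_le_of_norm_le
            ((integrableOn_log_div_mul_sqrt (x := x) (by linarith)).const_mul (3 * C)) ?_
          exact (ae_restrict_mem measurableSet_Ioi).mono fun t ht ↦
            hbd t (by linarith [mem_Ioi.1 ht])
      _ = 3 * C * ((2 * log x + 4) / √x) := by
          rw [integral_const_mul, integral_log_div_mul_sqrt (by linarith)]
      _ ≤ 3 * C * (8 * log x / √x) := by
          gcongr; linarith
      _ = _ := by ring
  have hEx : |E x / (x * log x)| ≤ C * (log x / √x) := by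
    rw [abs_div, abs_of_pos (by positivity : 0 < x * log x), div_le_iff₀ (by positivity)]
    refine (h x hx).trans_eq ?_
    have hss : √x ^ 2 = x := Real.sq_sqrt h0.le
    field_simp
    rw [hss]
  have key : ∑ p ∈ (Finset.Iic ⌊x⌋₊).filter Nat.Prime, 1 / (p : ℝ) - log (log x) -
      (1 / log 2 - log (log 2) + I) =
        E x / (x * log x) - ∫ t in Ioi x, mertensWeight t * E t := by
    rw [sum_one_div_prime_eq hx, log_log_eq hx, hsplit, htail]
    simp only [hE]
    ring
  rw [key]
  refine (abs_sub _ _).trans ?_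
  calc _ ≤ C * (log x / √x) + 3 * C * (8 * (log x / √x)) := add_le_add hEx htb
    _ = _ := by ring

end MertensSum

section MertensProductLog
open MeasureTheory

/-- The contribution of `n` to the logarithm of the Mertens product. -/
noncomputable def primeLog (n : ℕ) : ℝ := if n.Prime then -log (1 - 1 / (n : ℝ)) else 0

lemma one_div_prime_le {p : ℕ} (hp : p.Prime) : 1 / (p : ℝ) ≤ 1 / 2 :=
  one_div_le_one_div_of_le two_pos (by exact_mod_cast hp.two_le)

lemma abs_neg_log_one_sub_sub_le {q : ℝ} (hq : 0 ≤ q) (hq2 : q ≤ 1 / 2) :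
    |-log (1 - q) - q| ≤ 2 * q ^ 2 := by
  have h := Real.abs_log_sub_add_sum_range_le (x := q) (by rw [abs_of_nonneg hq]; linarith) 1
  simp only [Finset.range_one, Finset.sum_singleton, zero_add, pow_one, Nat.cast_zero, div_one,
    abs_of_nonneg hq] at h
  rw [← abs_neg, show -(-log (1 - q) - q) = q + log (1 - q) by ring]
  refine h.trans ?_
  rw [div_le_iff₀ (by linarith)]
  norm_num
  nlinarith [sq_nonneg q]

lemma primeLog_nonneg (n : ℕ) : 0 ≤ primeLog n := by
  unfold primeLog
  split_ifs with h
  · have := one_div_prime_le h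
    have h0 : 0 ≤ 1 / (n : ℝ) := by positivity
    exact neg_nonneg.2 (Real.log_nonpos (by linarith) (by linarith))
  · rfl

lemma log_mertensProd (x : ℝ) : log (mertensProd x) = ∑ n ∈ Finset.Iic ⌊x⌋₊, primeLog n := by
  rw [mertensProd, Real.log_prod, Finset.sum_filter]
  · refine Finset.sum_congr rfl fun n _ ↦ ?_
    rw [Real.log_inv, primeLog]
  · intro p hp
    have := one_div_prime_le (Finset.mem_filter.1 hp).2
    exact inv_ne_zero (by linarith)

lemma mertensProd_pos (x : ℝ) : 0 < mertensProd x := by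
  refine Finset.prod_pos fun p hp ↦ inv_pos.2 ?_
  linarith [one_div_prime_le (Finset.mem_filter.1 hp).2]

noncomputable def primeLogRem (n : ℕ) : ℝ :=
  if n.Prime then -log (1 - 1 / (n : ℝ)) - 1 / n else 0

lemma abs_primeLogRem_le (n : ℕ) : |primeLogRem n| ≤ 2 * (1 / (n : ℝ) ^ 2) := by
  unfold primeLogRem
  split_ifs with h
  · simpa only [one_div, inv_pow] using
      abs_neg_log_one_sub_sub_le (q := 1 / (n : ℝ)) (by positivity) (one_div_prime_le h)
  · rw [abs_zero]; positivity

lemma summable_primeLogRem : Summable primeLogRem :=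
  Summable.of_norm_bounded ((Real.summable_one_div_nat_pow.2 one_lt_two).mul_left 2)
    abs_primeLogRem_le

lemma exists_abs_sum_primeLogRem_sub_le : ∃ c C : ℝ, 0 < C ∧ ∀ x : ℝ, 1 ≤ x →
    |∑ n ∈ Finset.Iic ⌊x⌋₊, primeLogRem n - c| ≤ C / √x := by
  have hs : Summable fun n : ℕ ↦ 1 / (n : ℝ) ^ (3 / 2 : ℝ) :=
    Real.summable_one_div_nat_rpow.2 (by norm_num)
  have h0 : 0 ≤ ∑' n : ℕ, 1 / (n : ℝ) ^ (3 / 2 : ℝ) := tsum_nonneg fun n ↦ by positivity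
  refine ⟨∑' n, primeLogRem n, 2 * (∑' n : ℕ, 1 / (n : ℝ) ^ (3 / 2 : ℝ)) + 1, by positivity,
    fun x hx ↦ ?_⟩
  have hx0 : 0 < √x := Real.sqrt_pos.2 (by linarith)
  have hsplit := summable_primeLogRem.sum_add_tsum_compl (s := Finset.Iic ⌊x⌋₊)
  rw [← hsplit, sub_add_cancel_left, abs_neg, tsum_subtype]
  have hb : ∀ n : ℕ, ‖((↑(Finset.Iic ⌊x⌋₊) : Set ℕ)ᶜ).indicator primeLogRem n‖ ≤
      2 / √x * (1 / (n : ℝ) ^ (3 / 2 : ℝ)) := by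
    intro n
    by_cases hn : n ∈ ((↑(Finset.Iic ⌊x⌋₊) : Set ℕ)ᶜ)
    · rw [indicator_of_mem hn]
      have hxn : x < n := by
        simpa [Nat.floor_lt (by linarith : 0 ≤ x)] using hn
      have hn0 : (0 : ℝ) < n := by linarith
      calc _ ≤ 2 * (1 / (n : ℝ) ^ 2) := abs_primeLogRem_le n
        _ = 2 / √n * (1 / (n : ℝ) ^ (3 / 2 : ℝ)) := by
            rw [div_mul_div_comm, mul_one, Real.sqrt_eq_rpow, ← Real.rpow_add hn0]
            norm_num
            rfl
        _ ≤ _ := by gcongr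
    · rw [indicator_of_notMem hn, norm_zero]
      positivity
  calc _ ≤ ∑' n : ℕ, 2 / √x * (1 / (n : ℝ) ^ (3 / 2 : ℝ)) :=
        tsum_of_norm_bounded (hs.mul_left _).hasSum hb
    _ = 2 * (∑' n : ℕ, 1 / (n : ℝ) ^ (3 / 2 : ℝ)) / √x := by rw [tsum_mul_left]; ring
    _ ≤ _ := by gcongr; linarith

lemma exists_abs_log_mertensProd_sub_le (hRH : RiemannHypothesis) :
    ∃ c C : ℝ, 0 < C ∧ ∀ x : ℝ, 2 ≤ x →
      |log (mertensProd x) - log (log x) - c| ≤ C * log x / √x := by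
  obtain ⟨c₁, C₁, hC₁, h₁⟩ := exists_abs_sum_one_div_prime_sub_le hRH
  obtain ⟨c₂, C₂, hC₂, h₂⟩ := exists_abs_sum_primeLogRem_sub_le
  refine ⟨c₁ + c₂, C₁ + 2 * C₂, by positivity, fun x hx ↦ ?_⟩
  have hx0 : 0 < √x := Real.sqrt_pos.2 (by linarith)
  have hl : 1 ≤ 2 * log x := by
    linarith [Real.log_le_log two_pos hx, Real.log_two_gt_d9]
  have hsum : log (mertensProd x) = ∑ p ∈ (Finset.Iic ⌊x⌋₊).filter Nat.Prime, 1 / (p : ℝ) +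
      ∑ n ∈ Finset.Iic ⌊x⌋₊, primeLogRem n := by
    rw [log_mertensProd, Finset.sum_filter, ← Finset.sum_add_distrib]
    refine Finset.sum_congr rfl fun n _ ↦ ?_
    unfold primeLog primeLogRem
    split_ifs <;> ring
  rw [hsum]
  calc _ = |(∑ p ∈ (Finset.Iic ⌊x⌋₊).filter Nat.Prime, 1 / (p : ℝ) - log (log x) - c₁) +
        (∑ n ∈ Finset.Iic ⌊x⌋₊, primeLogRem n - c₂)| := by congr 1; ring
    _ ≤ C₁ * log x / √x + C₂ / √x :=
        (abs_add_le _ _).trans (add_le_add (h₁ x hx) (h₂ x (by linarith)))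
    _ ≤ C₁ * log x / √x + C₂ * (2 * log x) / √x := by
        gcongr
        nlinarith
    _ = _ := by ring

end MertensProductLog

section LogIntegral
open MeasureTheory

lemma abs_log_le_add {v : ℝ} (hv : 0 < v) : |log v| ≤ 2 * v ^ ((1 / 2 : ℝ) - 1) + v ^ ((2 : ℝ) - 1) := by
  have h1 : log v ≤ v ^ ((2 : ℝ) - 1) := by
    norm_num
    linarith [Real.log_le_sub_one_of_pos hv]
  have h2 : -log v ≤ 2 * v ^ ((1 / 2 : ℝ) - 1) := by
    have := Real.log_le_rpow_div (x := v⁻¹) (by positivity) (ε := 1 / 2) (by norm_num)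
    rw [Real.log_inv, Real.inv_rpow hv.le, ← Real.rpow_neg hv.le] at this
    norm_num at this ⊢
    linarith
  have h3 := Real.rpow_nonneg hv.le ((2 : ℝ) - 1)
  have h4 := Real.rpow_nonneg hv.le ((1 / 2 : ℝ) - 1)
  exact abs_le.2 ⟨(neg_le.1 h2).trans' (neg_le_neg (le_add_of_nonneg_right h3)),
    h1.trans (le_add_of_nonneg_left (mul_nonneg zero_le_two h4))⟩

lemma integrableOn_log_mul_exp_neg : IntegrableOn (fun v ↦ log v * exp (-v)) (Ioi 0) := by
  refine (((Real.GammaIntegral_convergent (s := 1 / 2) (by norm_num)).const_mul 2).add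
    (Real.GammaIntegral_convergent (s := 2) (by norm_num))).mono' (by fun_prop) ?_
  filter_upwards [ae_restrict_mem measurableSet_Ioi] with v hv
  rw [norm_mul, Real.norm_eq_abs, Real.norm_eq_abs, Real.abs_exp]
  calc _ ≤ (2 * v ^ ((1 / 2 : ℝ) - 1) + v ^ ((2 : ℝ) - 1)) * exp (-v) := by
        gcongr
        exact abs_log_le_add hv
    _ = _ := by simp only [Pi.add_apply]; ring

lemma integral_log_mul_exp_neg :
    ∫ v in Ioi (0 : ℝ), log v * exp (-v) = -Real.eulerMascheroniConstant := by
  have h1 := Complex.hasDerivAt_GammaIntegral (s := 1) (by simp)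
  have h2 : HasDerivAt Complex.GammaIntegral (-Real.eulerMascheroniConstant : ℂ) 1 := by
    refine Complex.hasDerivAt_Gamma_one.congr_of_eventuallyEq ?_
    filter_upwards [(isOpen_lt continuous_const Complex.continuous_re).mem_nhds
      (show (0 : ℝ) < (1 : ℂ).re by simp)] with a ha
    exact (Complex.Gamma_eq_integral ha).symm
  have h3 := h1.unique h2
  simp only [sub_self, Complex.cpow_zero, one_mul] at h3
  have h4 : ((∫ v in Ioi (0 : ℝ), log v * exp (-v) : ℝ) : ℂ) =
      ((-Real.eulerMascheroniConstant : ℝ) : ℂ) := by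
    rw [← integral_complex_ofReal]
    push_cast
    push_cast at h3
    exact h3
  exact_mod_cast h4

lemma primeLog_le (n : ℕ) : primeLog n ≤ 2 * (1 / (n : ℝ)) := by
  unfold primeLog
  split_ifs with h
  · have h1 := one_div_prime_le h
    have h0 : 0 ≤ 1 / (n : ℝ) := by positivity
    have := abs_le.1 (abs_neg_log_one_sub_sub_le h0 h1)
    nlinarith
  · positivity

lemma summable_primeLog_mul_rpow {ε : ℝ} (hε : 0 < ε) :
    Summable fun n : ℕ ↦ primeLog n * (n : ℝ) ^ (-ε) := by
  refine Summable.of_nonneg_of_le (fun n ↦ mul_nonneg (primeLog_nonneg n) (by positivity))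
    (fun n ↦ ?_) ((Real.summable_one_div_nat_rpow.2 (by linarith : 1 < 1 + ε)).mul_left 2)
  rcases Nat.eq_zero_or_pos n with rfl | hn
  · simp [primeLog]
    positivity
  have hn' : (0 : ℝ) < n := by exact_mod_cast hn
  calc _ ≤ 2 * (1 / (n : ℝ)) * (n : ℝ) ^ (-ε) := by gcongr; exact primeLog_le n
    _ = _ := by
      rw [Real.rpow_neg hn'.le, Real.rpow_add hn', Real.rpow_one]
      field_simp

lemma tsum_primeLog_mul_rpow {ε : ℝ} (hε : 0 < ε) :
    ∑' n : ℕ, primeLog n * (n : ℝ) ^ (-ε) =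
      ∫ v in Ioi (0 : ℝ), log (mertensProd (exp (v / ε))) * exp (-v) := by
  set F : ℕ → ℝ → ℝ := fun n ↦ (Ici (ε * log n)).indicator fun v ↦ primeLog n * exp (-v)
  have hexp (c : ℝ) : IntegrableOn (fun v ↦ exp (-v)) (Ioi c) := by
    simpa using integrableOn_exp_mul_Ioi (a := -1) (by norm_num) c
  have hint (n : ℕ) : Integrable (F n) (volume.restrict (Ioi 0)) :=
    ((hexp 0).const_mul (primeLog n)).indicator measurableSet_Ici
  have hval (n : ℕ) : ∫ v in Ioi (0 : ℝ), F n v = primeLog n * (n : ℝ) ^ (-ε) := by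
    by_cases hn : n.Prime
    · have hn1 : (1 : ℝ) < n := by exact_mod_cast hn.one_lt
      have hl : 0 < ε * log n := mul_pos hε (Real.log_pos hn1)
      rw [setIntegral_indicator measurableSet_Ici,
        inter_eq_right.2 (Ici_subset_Ioi.2 hl), integral_Ici_eq_integral_Ioi,
        integral_const_mul, integral_exp_neg_Ioi, Real.rpow_def_of_pos (by linarith)]
      ring_nf
    · simp [F, primeLog, hn]
  have hnonneg (n : ℕ) (v : ℝ) : 0 ≤ F n v :=
    indicator_nonneg (fun v _ ↦ mul_nonneg (primeLog_nonneg n) (exp_pos _).le) v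
  have hsum : Summable fun n ↦ ∫ v in Ioi (0 : ℝ), ‖F n v‖ := by
    simp_rw [Real.norm_of_nonneg (hnonneg _ _), hval]
    exact summable_primeLog_mul_rpow hε
  have key := integral_tsum_of_summable_integral_norm hint hsum
  simp_rw [hval] at key
  rw [key]
  refine setIntegral_congr_fun measurableSet_Ioi fun v _ ↦ ?_
  rw [log_mertensProd, Finset.sum_mul, tsum_eq_sum (s := Finset.Iic ⌊exp (v / ε)⌋₊)]
  · refine Finset.sum_congr rfl fun n hn ↦ ?_
    by_cases hp : n.Prime
    · refine indicator_of_mem ?_ _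
      have hn0 : (0 : ℝ) < n := by exact_mod_cast hp.pos
      rw [Finset.mem_Iic, Nat.le_floor_iff (exp_pos _).le, ← Real.log_le_iff_le_exp hn0,
        le_div_iff₀ hε] at hn
      rw [mem_Ici]
      linarith
    · simp [F, primeLog, hp]
  · intro n hn
    by_cases hp : n.Prime
    · refine indicator_of_notMem ?_ _
      have hn0 : (0 : ℝ) < n := by exact_mod_cast hp.pos
      rw [Finset.mem_Iic, Nat.le_floor_iff (exp_pos _).le, ← Real.log_le_iff_le_exp hn0,
        le_div_iff₀ hε] at hn
      rw [mem_Ici]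
      linarith
    · simp [F, primeLog, hp]

end LogIntegral

section MertensConstant
open MeasureTheory

lemma log_div_sqrt_le {x : ℝ} (hx : 0 < x) : log x / √x ≤ 2 := by
  have h0 : 0 < √x := Real.sqrt_pos.2 hx
  have := Real.log_le_sub_one_of_pos h0
  rw [Real.log_sqrt hx.le] at this
  rw [div_le_iff₀ h0]
  linarith

lemma tendsto_log_div_sqrt : Tendsto (fun x : ℝ ↦ log x / √x) atTop (nhds 0) := by
  simp_rw [Real.sqrt_eq_rpow]
  exact (isLittleO_log_rpow_atTop (r := 1 / 2) (by norm_num)).tendsto_div_nhds_zero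

lemma mertensProd_of_lt_two {x : ℝ} (hx : x < 2) : mertensProd x = 1 := by
  refine Finset.prod_eq_one fun p hp ↦ ?_
  have hp' := Finset.mem_filter.1 hp
  have h2 := hp'.2.two_le
  have h1 : ⌊x⌋₊ < 2 := (Nat.floor_lt' two_ne_zero).2 (by exact_mod_cast hx)
  have := Finset.mem_Iic.1 hp'.1
  omega

lemma measurable_mertensProd : Measurable mertensProd := by
  unfold mertensProd
  exact (measurable_from_nat (f := fun k ↦
    ∏ p ∈ Finset.filter Nat.Prime (Finset.Iic k), ((1 : ℝ) - 1 / p)⁻¹)).comp Nat.measurable_floor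

variable {c C : ℝ}

lemma tendsto_log_mertensProd_exp_add_log
    (h : ∀ x : ℝ, 2 ≤ x → |log (mertensProd x) - log (log x) - c| ≤ C * log x / √x)
    {v : ℝ} (hv : 0 < v) :
    Tendsto (fun ε : ℝ ↦ log (mertensProd (exp (v / ε))) + log ε) (nhdsWithin 0 (Ioi 0))
      (nhds (log v + c)) := by
  have hexp : Tendsto (fun ε : ℝ ↦ exp (v / ε)) (nhdsWithin 0 (Ioi 0)) atTop :=
    Real.tendsto_exp_atTop.comp (tendsto_inv_nhdsGT_zero.const_mul_atTop hv)
  have hb : Tendsto (fun ε : ℝ ↦ C * (log (exp (v / ε)) / √(exp (v / ε))))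
      (nhdsWithin 0 (Ioi 0)) (nhds 0) := by
    simpa using (tendsto_log_div_sqrt.comp hexp).const_mul C
  rw [tendsto_iff_norm_sub_tendsto_zero]
  refine squeeze_zero' (Eventually.of_forall fun _ ↦ norm_nonneg _) ?_ hb
  filter_upwards [hexp.eventually_ge_atTop 2, self_mem_nhdsWithin] with ε h2 hε
  have hε' : (0 : ℝ) < ε := hε
  have := h _ h2
  rw [Real.log_exp, Real.log_div hv.ne' hε'.ne'] at this
  rw [Real.norm_eq_abs, Real.log_exp, ← mul_div_assoc]
  convert this using 2
  ring

lemma abs_log_mertensProd_exp_add_log_le (hC : 0 < C)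
    (h : ∀ x : ℝ, 2 ≤ x → |log (mertensProd x) - log (log x) - c| ≤ C * log x / √x)
    {v ε : ℝ} (hv : 0 < v) (hε : 0 < ε) (hε1 : ε < 1) :
    |log (mertensProd (exp (v / ε))) + log ε| ≤ |log v| + (|c| + 2 * C) := by
  rcases lt_or_ge (exp (v / ε)) 2 with h2 | h2
  · rw [mertensProd_of_lt_two h2, Real.log_one, zero_add]
    have hl : v / ε < 1 := by
      rw [← Real.exp_lt_exp]
      linarith [Real.exp_one_gt_d9]
    have hve : v < ε := by rwa [div_lt_one hε] at hl
    have h3 := Real.log_lt_log hv hve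
    have h4 := Real.log_neg hε hε1
    rw [abs_of_neg h4, abs_of_neg (h3.trans h4)]
    have := abs_nonneg c
    linarith
  · have h3 := h _ h2
    have h4 := log_div_sqrt_le (exp_pos (v / ε))
    rw [mul_div_assoc] at h3
    have h5 := mul_le_mul_of_nonneg_left h4 hC.le
    rw [Real.log_exp] at h5
    rw [Real.log_exp, Real.log_div hv.ne' hε.ne'] at h3
    calc _ = |(log (mertensProd (exp (v / ε))) - (log v - log ε) - c) + log v + c| := by
          congr 1; ring
      _ ≤ _ := by
        refine (abs_add_le _ _).trans ?_
        have := abs_add_le (log (mertensProd (exp (v / ε))) - (log v - log ε) - c) (log v)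
        linarith

lemma tendsto_tsum_primeLog_add_log (hC : 0 < C)
    (h : ∀ x : ℝ, 2 ≤ x → |log (mertensProd x) - log (log x) - c| ≤ C * log x / √x) :
    Tendsto (fun ε : ℝ ↦ ∑' n : ℕ, primeLog n * (n : ℝ) ^ (-ε) + log ε) (nhdsWithin 0 (Ioi 0))
      (nhds (c - Real.eulerMascheroniConstant)) := by
  have hexp : IntegrableOn (fun v : ℝ ↦ exp (-v)) (Ioi 0) := by
    simpa using integrableOn_exp_mul_Ioi (a := -1) (by norm_num) 0
  have hmeas (ε : ℝ) : Measurable fun v : ℝ ↦ log (mertensProd (exp (v / ε))) :=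
    Real.measurable_log.comp (measurable_mertensProd.comp (by fun_prop))
  set bound : ℝ → ℝ := fun v ↦ ‖log v * exp (-v)‖ + (|c| + 2 * C) * exp (-v)
  have hbound : IntegrableOn bound (Ioi 0) :=
    integrableOn_log_mul_exp_neg.norm.add (hexp.const_mul _)
  have hle {v ε : ℝ} (hv : 0 < v) (hε : 0 < ε) (hε1 : ε < 1) :
      ‖(log (mertensProd (exp (v / ε))) + log ε) * exp (-v)‖ ≤ bound v := by
    simp only [bound, norm_mul, Real.norm_eq_abs, Real.abs_exp]
    rw [← add_mul]
    gcongr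
    exact abs_log_mertensProd_exp_add_log_le hC h hv hε hε1
  have hlim : ∫ v in Ioi (0 : ℝ), (log v + c) * exp (-v) = c - Real.eulerMascheroniConstant := by
    simp_rw [add_mul]
    rw [integral_add integrableOn_log_mul_exp_neg (hexp.const_mul _), integral_log_mul_exp_neg,
      integral_const_mul, integral_exp_neg_Ioi_zero]
    ring
  have hsmall : ∀ᶠ ε : ℝ in nhdsWithin 0 (Ioi 0), ε < 1 :=
    (eventually_lt_nhds one_pos).filter_mono nhdsWithin_le_nhds
  rw [← hlim]
  refine (tendsto_integral_filter_of_dominated_convergence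
    (F := fun ε v ↦ (log (mertensProd (exp (v / ε))) + log ε) * exp (-v)) bound ?_ ?_ hbound
    ?_).congr' ?_
  · exact Eventually.of_forall fun ε ↦
      (((hmeas ε).add_const _).mul (by fun_prop)).aestronglyMeasurable
  · filter_upwards [hsmall, self_mem_nhdsWithin] with ε hε1 hε
    filter_upwards [ae_restrict_mem measurableSet_Ioi] with v hv using hle hv hε hε1
  · filter_upwards [ae_restrict_mem measurableSet_Ioi] with v hv
    exact (tendsto_log_mertensProd_exp_add_log h hv).mul_const _
  · filter_upwards [hsmall, self_mem_nhdsWithin] with ε hε1 hε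
    have hint : IntegrableOn
        (fun v ↦ (log (mertensProd (exp (v / ε))) + log ε) * exp (-v)) (Ioi 0) := by
      refine hbound.mono' (((hmeas ε).add_const _).mul (by fun_prop)).aestronglyMeasurable ?_
      filter_upwards [ae_restrict_mem measurableSet_Ioi] with v hv using hle hv hε hε1
    have hone : ∫ v in Ioi (0 : ℝ), log ε * exp (-v) = log ε := by
      rw [integral_const_mul, integral_exp_neg_Ioi_zero, mul_one]
    rw [tsum_primeLog_mul_rpow hε, ← sub_eq_iff_eq_add]
    nth_rw 2 [← hone]
    rw [← integral_sub hint (hexp.const_mul _)]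
    refine setIntegral_congr_fun measurableSet_Ioi fun v _ ↦ ?_
    ring

end MertensConstant

section EulerProductLog

/-- The contribution of `n` to the logarithm of the Euler product of `ζ` at `1 + ε`. -/
noncomputable def eulerLog (ε : ℝ) (n : ℕ) : ℝ :=
  if n.Prime then -log (1 - (n : ℝ) ^ (-(1 + ε))) else 0

lemma rpow_neg_one_add_le {p : ℕ} (hp : p.Prime) {ε : ℝ} (hε : 0 ≤ ε) :
    (p : ℝ) ^ (-(1 + ε)) ≤ 1 / p := by
  have h1 : (1 : ℝ) ≤ p := by exact_mod_cast hp.one_le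
  rw [one_div, ← Real.rpow_neg_one]
  exact Real.rpow_le_rpow_of_exponent_le h1 (by linarith)

lemma abs_eulerLog_sub_le {ε : ℝ} (hε : 0 ≤ ε) (n : ℕ) :
    |eulerLog ε n - primeLog n * (n : ℝ) ^ (-ε)| ≤ 4 * (1 / (n : ℝ) ^ 2) := by
  unfold eulerLog primeLog
  split_ifs with hp
  · have hn : (1 : ℝ) ≤ n := by exact_mod_cast hp.one_le
    have hn0 : (0 : ℝ) < n := by linarith
    have hq := one_div_prime_le hp
    have hq' := rpow_neg_one_add_le hp hε
    have hq0 : 0 ≤ (n : ℝ) ^ (-(1 + ε)) := by positivity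
    have hmul : (n : ℝ) ^ (-(1 + ε)) = 1 / n * (n : ℝ) ^ (-ε) := by
      rw [neg_add, Real.rpow_add hn0, Real.rpow_neg_one, one_div]
    have hle1 : (n : ℝ) ^ (-ε) ≤ 1 := Real.rpow_le_one_of_one_le_of_nonpos hn (by linarith)
    have h0 : 0 ≤ (n : ℝ) ^ (-ε) := by positivity
    have h1 := abs_neg_log_one_sub_sub_le hq0 (hq'.trans hq)
    have h2 := abs_neg_log_one_sub_sub_le (q := 1 / (n : ℝ)) (by positivity) hq
    have h3 : ((n : ℝ) ^ (-(1 + ε))) ^ 2 ≤ (1 / (n : ℝ)) ^ 2 := by gcongr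
    calc _ = |(-log (1 - (n : ℝ) ^ (-(1 + ε))) - (n : ℝ) ^ (-(1 + ε))) -
          (-log (1 - 1 / (n : ℝ)) - 1 / n) * (n : ℝ) ^ (-ε)| := by rw [hmul]; congr 1; ring
      _ ≤ 2 * ((n : ℝ) ^ (-(1 + ε))) ^ 2 + 2 * (1 / (n : ℝ)) ^ 2 * 1 := by
          refine (abs_sub _ _).trans ?_
          rw [abs_mul, abs_of_nonneg h0]
          gcongr
      _ ≤ 4 * (1 / (n : ℝ)) ^ 2 := by linarith
      _ = _ := by rw [one_div_pow]
  · rw [zero_mul, sub_zero, abs_zero]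
    positivity

lemma tendsto_eulerLog_sub (n : ℕ) :
    Tendsto (fun ε : ℝ ↦ eulerLog ε n - primeLog n * (n : ℝ) ^ (-ε)) (nhdsWithin 0 (Ioi 0))
      (nhds 0) := by
  unfold eulerLog primeLog
  split_ifs with hp
  · have hn0 : (0 : ℝ) < n := by exact_mod_cast hp.pos
    have hne : (1 : ℝ) - (n : ℝ) ^ (-(1 + (0 : ℝ))) ≠ 0 := by
      rw [add_zero, Real.rpow_neg_one, ← one_div]
      linarith [one_div_prime_le hp]
    have hcont : ContinuousAt (fun ε : ℝ ↦ -log (1 - (n : ℝ) ^ (-(1 + ε))) -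
        -log (1 - 1 / (n : ℝ)) * (n : ℝ) ^ (-ε)) 0 := by
      have h1 : Continuous fun ε : ℝ ↦ (n : ℝ) ^ (-(1 + ε)) :=
        continuous_const.rpow (by fun_prop) fun _ ↦ .inl hn0.ne'
      have h2 : Continuous fun ε : ℝ ↦ (n : ℝ) ^ (-ε) :=
        continuous_const.rpow (by fun_prop) fun _ ↦ .inl hn0.ne'
      exact (((continuous_const.sub h1).continuousAt.log hne).neg).sub
        (continuous_const.mul h2).continuousAt
    have := hcont.tendsto
    simp only [add_zero, neg_zero, Real.rpow_zero, mul_one, Real.rpow_neg_one, one_div,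
      sub_self] at this
    simpa only [one_div] using this.mono_left nhdsWithin_le_nhds
  · simp

lemma summable_eulerLog {ε : ℝ} (hε : 0 < ε) : Summable (eulerLog ε) := by
  have h := (Summable.of_norm_bounded
    ((Real.summable_one_div_nat_pow.2 one_lt_two).mul_left 4) (abs_eulerLog_sub_le hε.le)).add
    (summable_primeLog_mul_rpow hε)
  simpa using h

lemma exp_tsum_eulerLog {ε : ℝ} (hε : 0 < ε) :
    ((exp (∑' n, eulerLog ε n) : ℝ) : ℂ) = riemannZeta (1 + ε) := by
  rw [← riemannZeta_eulerProduct_exp_log (by simpa using hε), Complex.ofReal_exp]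
  congr 1
  have h1 : ∑' n, eulerLog ε n = ∑' p : Nat.Primes, eulerLog ε p := by
    refine (tsum_subtype_eq_of_support_subset (s := {p : ℕ | p.Prime}) fun n hn ↦ ?_).symm
    by_contra h
    exact hn (if_neg h)
  rw [h1, Complex.ofReal_tsum]
  refine tsum_congr fun p ↦ ?_
  have hp := p.2
  have h2 := (rpow_neg_one_add_le hp hε.le).trans (one_div_prime_le hp)
  rw [eulerLog, if_pos hp, Complex.ofReal_neg, Complex.ofReal_log (by linarith)]
  push_cast
  rw [Complex.ofReal_cpow (by positivity)]
  push_cast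
  rfl

lemma tendsto_tsum_eulerLog_add_log :
    Tendsto (fun ε : ℝ ↦ ∑' n, eulerLog ε n + log ε) (nhdsWithin 0 (Ioi 0)) (nhds 0) := by
  have h1 : Tendsto (fun ε : ℝ ↦ (1 + ε : ℂ)) (nhdsWithin 0 (Ioi 0)) (nhdsWithin 1 {1}ᶜ) := by
    refine tendsto_nhdsWithin_of_tendsto_nhds_of_eventually_within _ ?_ ?_
    · have : Continuous fun ε : ℝ ↦ (1 + ε : ℂ) := by fun_prop
      simpa using (this.tendsto 0).mono_left nhdsWithin_le_nhds
    · filter_upwards [self_mem_nhdsWithin] with ε hε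
      simpa using (ne_of_gt hε : ε ≠ 0)
  have h2 := (Complex.continuous_re.tendsto _).comp (riemannZeta_residue_one.comp h1)
  have h3 : Tendsto (fun ε : ℝ ↦ ε * exp (∑' n, eulerLog ε n)) (nhdsWithin 0 (Ioi 0))
      (nhds 1) := by
    refine h2.congr' ?_
    filter_upwards [self_mem_nhdsWithin] with ε hε
    simp only [Function.comp_apply, add_sub_cancel_left]
    rw [← exp_tsum_eulerLog hε, ← Complex.ofReal_mul, Complex.ofReal_re]
  have h4 := h3.log one_ne_zero
  rw [Real.log_one] at h4
  refine h4.congr' ?_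
  filter_upwards [self_mem_nhdsWithin] with ε hε
  rw [Real.log_mul (ne_of_gt hε) (exp_pos _).ne', Real.log_exp, add_comm]

lemma tendsto_tsum_primeLog_add_log_zero :
    Tendsto (fun ε : ℝ ↦ ∑' n : ℕ, primeLog n * (n : ℝ) ^ (-ε) + log ε) (nhdsWithin 0 (Ioi 0))
      (nhds 0) := by
  have h1 : Tendsto (fun ε : ℝ ↦ ∑' n : ℕ, (eulerLog ε n - primeLog n * (n : ℝ) ^ (-ε)))
      (nhdsWithin 0 (Ioi 0)) (nhds (∑' _ : ℕ, (0 : ℝ))) := by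
    refine tendsto_tsum_of_dominated_convergence
      ((Real.summable_one_div_nat_pow.2 one_lt_two).mul_left 4) tendsto_eulerLog_sub ?_
    filter_upwards [self_mem_nhdsWithin] with ε hε n using abs_eulerLog_sub_le (le_of_lt hε) n
  rw [tsum_zero] at h1
  have h2 := tendsto_tsum_eulerLog_add_log.sub h1
  rw [sub_zero] at h2
  refine h2.congr' ?_
  filter_upwards [self_mem_nhdsWithin] with ε hε
  rw [(summable_eulerLog hε).tsum_sub (summable_primeLog_mul_rpow hε)]
  ring

end EulerProductLog

section MertensProductRH

lemma exists_abs_log_mertensProd_sub_eulerMascheroniConstant_le (hRH : RiemannHypothesis) :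
    ∃ C : ℝ, 0 < C ∧ ∀ x : ℝ, 2 ≤ x →
      |log (mertensProd x) - log (log x) - Real.eulerMascheroniConstant| ≤ C * log x / √x := by
  obtain ⟨c, C, hC, h⟩ := exists_abs_log_mertensProd_sub_le hRH
  have hc := tendsto_nhds_unique (tendsto_tsum_primeLog_add_log hC h)
    tendsto_tsum_primeLog_add_log_zero
  rw [sub_eq_zero] at hc
  exact ⟨C, hC, hc ▸ h⟩

lemma abs_exp_sub_one_sub_le {d M : ℝ} (hd : |d| ≤ M) :
    |exp d - 1 - d| ≤ exp M * d ^ 2 := by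
  have h1 := Real.add_one_le_exp d
  have h2 := Real.add_one_le_exp (-d)
  have h3 : exp d * exp (-d) = 1 := by rw [← Real.exp_add, add_neg_cancel, Real.exp_zero]
  have h4 : exp d ≤ exp M := Real.exp_le_exp.2 ((le_abs_self d).trans hd)
  have h5 : 1 ≤ exp M := Real.one_le_exp ((abs_nonneg d).trans hd)
  rw [abs_of_nonneg (by linarith)]
  rcases le_or_gt 0 d with h | h
  · have : exp d - 1 ≤ d * exp d := by nlinarith [exp_pos d]
    nlinarith
  · have h6 : exp d ≤ 1 := Real.exp_le_one_iff.2 h.le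
    have : exp d - 1 ≤ d * exp d := by nlinarith [exp_pos d]
    nlinarith [sq_nonneg d]

end MertensProductRH

/-- Assuming RH,
`∏_{p≤x}(1-1/p)⁻¹ = e^γ log x + e^γ E_M(x)/√x + O((log x)³/x)`. -/
theorem mertensProd_approx (hRH : RiemannHypothesis) :
    ∃ C : ℝ, 0 < C ∧ ∀ x : ℝ, 5 ≤ x →
      |mertensProd x - Real.exp Real.eulerMascheroniConstant * Real.log x -
          Real.exp Real.eulerMascheroniConstant * EM x / Real.sqrt x| ≤
        C * (Real.log x) ^ 3 / x := by
  obtain ⟨C, hC, h⟩ := exists_abs_log_mertensProd_sub_eulerMascheroniConstant_le hRH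
  refine ⟨exp Real.eulerMascheroniConstant * exp (2 * C) * C ^ 2, by positivity, fun x hx ↦ ?_⟩
  have hx0 : 0 < x := by linarith
  have hs : 0 < √x := Real.sqrt_pos.2 hx0
  have hl : 0 < log x := Real.log_pos (by linarith)
  set γ := Real.eulerMascheroniConstant
  set d := log (mertensProd x) - log (log x) - γ with hd
  have hdx : |d| ≤ C * log x / √x := h x (by linarith)
  have hd2 : |d| ≤ 2 * C := by
    refine hdx.trans ?_
    rw [mul_div_assoc, mul_comm 2]
    exact mul_le_mul_of_nonneg_left (log_div_sqrt_le hx0) hC.le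
  have hm : mertensProd x = exp γ * log x * exp d := by
    rw [← Real.exp_log (mertensProd_pos x),
      show log (mertensProd x) = γ + log (log x) + d by rw [hd]; ring, Real.exp_add, Real.exp_add,
      Real.exp_log hl]
  have hE : exp γ * EM x / √x = exp γ * log x * d := by
    rw [EM]
    field_simp
    rfl
  have hsq : d ^ 2 ≤ C ^ 2 * log x ^ 2 / x := by
    rw [← sq_abs]
    calc |d| ^ 2 ≤ (C * log x / √x) ^ 2 := by gcongr
      _ = _ := by rw [div_pow, mul_pow, Real.sq_sqrt hx0.le]
  rw [hE, hm]
  calc _ = exp γ * log x * |exp d - 1 - d| := by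
        rw [← abs_of_pos (mul_pos (exp_pos γ) hl), ← abs_mul, abs_of_pos (mul_pos (exp_pos γ) hl)]
        congr 1
        ring
    _ ≤ exp γ * log x * (exp (2 * C) * (C ^ 2 * log x ^ 2 / x)) := by
        gcongr
        exact (abs_exp_sub_one_sub_le hd2).trans (by gcongr)
    _ = _ := by ring
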